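/- For each fixed triple (k, l, m) with k, l ≥ 1 and m ≥ 0, there are only finitely many →II-homology types of rectangular diagrams R with ω_→II(R) = (k, l, m). -/

import Mathlib

open Set

noncomputable section

/-- The circle `S¹`, modeled as `ℝ/ℤ`. -/
abbrev 𝕊 : Type := AddCircle (1 : ℝ)

/-- The torus `T² = S¹ × S¹`. -/
abbrev Torus : Type := 𝕊 × 𝕊

instance : Fact ((0:ℝ) < 1) := ⟨one_pos⟩

/-- The representative of a point of `S¹` in `[0,1)`. -/
noncomputable def toIco (x : 𝕊) : ℝ := (AddCircle.equivIco 1 0 x).1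

/-- The closed positively oriented arc `[a;b]` in `S¹`. -/
def closedArc (a b : 𝕊) : Set 𝕊 := {x | toIco (x - a) ≤ toIco (b - a)}

/-- The open positively oriented arc `(a;b)` in `S¹`. -/
def openArc (a b : 𝕊) : Set 𝕊 := {x | 0 < toIco (x - a) ∧ toIco (x - a) < toIco (b - a)}

/-- An oriented rectangular diagram of a link. -/
structure RectDiagram where
  pos : Finset Torus
  neg : Finset Torus
  disj : Disjoint pos neg
  nonempty : (pos ∪ neg).Nonempty
  thetaEq : pos.image Prod.fst = neg.image Prod.fst
  phiEq : pos.image Prod.snd = neg.image Prod.snd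
  thetaInjPos : Set.InjOn Prod.fst (pos : Set Torus)
  thetaInjNeg : Set.InjOn Prod.fst (neg : Set Torus)
  phiInjPos : Set.InjOn Prod.snd (pos : Set Torus)
  phiInjNeg : Set.InjOn Prod.snd (neg : Set Torus)

namespace RectDiagram

/-- The set of vertices of a rectangular diagram. -/
def verts (R : RectDiagram) : Finset Torus := R.pos ∪ R.neg

/-- The projection of the vertex set to the `θ`-circle. -/
def pθ (R : RectDiagram) : Finset 𝕊 := R.verts.image Prod.fst

/-- The projection of the vertex set to the `φ`-circle. -/
def pφ (R : RectDiagram) : Finset 𝕊 := R.verts.image Prod.snd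

/-- Vertical edges: unordered pairs of distinct vertices with equal `θ`-coordinate. -/
def vertEdges (R : RectDiagram) : Set (Finset Torus) :=
  {e | ∃ u ∈ R.verts, ∃ v ∈ R.verts, u ≠ v ∧ u.1 = v.1 ∧ e = {u, v}}

/-- Horizontal edges: unordered pairs of distinct vertices with equal `φ`-coordinate. -/
def horizEdges (R : RectDiagram) : Set (Finset Torus) :=
  {e | ∃ u ∈ R.verts, ∃ v ∈ R.verts, u ≠ v ∧ u.2 = v.2 ∧ e = {u, v}}

end RectDiagram

/-- A set of one, two, or three consecutive corners of the rectangle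
`[θ₁;θ₂] × [φ₁;φ₂]` (in the cyclic order of the corners). -/
def ConsecCorners (θ₁ θ₂ φ₁ φ₂ : 𝕊) (s : Set Torus) : Prop :=
  let c₁ : Torus := (θ₁, φ₁); let c₂ : Torus := (θ₂, φ₁)
  let c₃ : Torus := (θ₂, φ₂); let c₄ : Torus := (θ₁, φ₂)
  s = {c₁} ∨ s = {c₂} ∨ s = {c₃} ∨ s = {c₄} ∨
  s = {c₁, c₂} ∨ s = {c₂, c₃} ∨ s = {c₃, c₄} ∨ s = {c₄, c₁} ∨
  s = {c₁, c₂, c₃} ∨ s = {c₂, c₃, c₄} ∨ s = {c₃, c₄, c₁} ∨ s = {c₄, c₁, c₂}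

/-- An elementary move `R₁ ↦ R₂` with the given data `θ₁, θ₂, φ₁, φ₂`. -/
def ElemMoveData (R₁ R₂ : RectDiagram) (θ₁ θ₂ φ₁ φ₂ : 𝕊) : Prop :=
  θ₁ ≠ θ₂ ∧ φ₁ ≠ φ₂ ∧
  symmDiff (↑R₁.verts : Set Torus) ↑R₂.verts = ({θ₁, θ₂} : Set 𝕊) ×ˢ ({φ₁, φ₂} : Set 𝕊) ∧
  (closedArc θ₁ θ₂ ×ˢ closedArc φ₁ φ₂) ∩ ((↑R₁.verts : Set Torus) ∪ ↑R₂.verts)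
    = symmDiff (↑R₁.verts : Set Torus) ↑R₂.verts ∧
  (∃ s : Set Torus, ConsecCorners θ₁ θ₂ φ₁ φ₂ s ∧
    (↑R₁.verts : Set Torus) ∩ (({θ₁, θ₂} : Set 𝕊) ×ˢ ({φ₁, φ₂} : Set 𝕊)) = s ∧
    (({θ₁, θ₂} : Set 𝕊) ×ˢ ({φ₁, φ₂} : Set 𝕊)) \ s ⊆ (↑R₂.verts : Set Torus)) ∧
  ((↑R₁.pos : Set Torus) ∩ ↑R₂.verts = (↑R₁.verts : Set Torus) ∩ ↑R₂.pos)

/-- An elementary move of rectangular diagrams. -/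
def ElemMove (R₁ R₂ : RectDiagram) : Prop :=
  ∃ θ₁ θ₂ φ₁ φ₂, ElemMoveData R₁ R₂ θ₁ θ₂ φ₁ φ₂

/-- An exchange move. -/
def ExchangeMove (R₁ R₂ : RectDiagram) : Prop :=
  ElemMove R₁ R₂ ∧ R₁.verts.card = R₂.verts.card

/-- A stabilization move. -/
def Stab (R₁ R₂ : RectDiagram) : Prop :=
  ElemMove R₁ R₂ ∧ R₂.verts.card = R₁.verts.card + 2

/-- A destabilization move. -/
def Destab (R₁ R₂ : RectDiagram) : Prop :=
  ElemMove R₁ R₂ ∧ R₁.verts.card = R₂.verts.card + 2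

/-- The four oriented types of stabilizations: `→I`, `←I`, `→II`, `←II`. -/
inductive OType | rI | lI | rII | lII
deriving DecidableEq

/-- A stabilization `R₁ ↦ R₂` with data `θ₁, θ₂, φ₁, φ₂` has oriented type `T`:
`v` is the (unique) vertex of `R₁` in the rectangle, type I means
`v ∈ {(θ₁,φ₁),(θ₂,φ₂)}`, type II means `v ∈ {(θ₁,φ₂),(θ₂,φ₁)}`, and the arrow is
`→` or `←` according to the sign of `(θ₂,φ₀)` in `R₂`, where
`{θ₁,θ₂} × {φ₀} ⊆ R₂`. -/
def StabTypeData (R₁ R₂ : RectDiagram) (θ₁ θ₂ φ₁ φ₂ : 𝕊) (T : OType) : Prop :=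
  ∃ v ∈ (↑R₁.verts : Set Torus) ∩ (closedArc θ₁ θ₂ ×ˢ closedArc φ₁ φ₂),
    ∃ φ₀ ∈ ({φ₁, φ₂} : Set 𝕊), (θ₁, φ₀) ∈ R₂.verts ∧ (θ₂, φ₀) ∈ R₂.verts ∧
    (match T with
     | .rI => (v = (θ₁, φ₁) ∨ v = (θ₂, φ₂)) ∧ (θ₂, φ₀) ∈ R₂.pos
     | .lI => (v = (θ₁, φ₁) ∨ v = (θ₂, φ₂)) ∧ (θ₂, φ₀) ∈ R₂.neg
     | .rII => (v = (θ₁, φ₂) ∨ v = (θ₂, φ₁)) ∧ (θ₂, φ₀) ∈ R₂.pos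
     | .lII => (v = (θ₁, φ₂) ∨ v = (θ₂, φ₁)) ∧ (θ₂, φ₀) ∈ R₂.neg)

/-- A stabilization of oriented type `T`. -/
def StabOfType (R₁ R₂ : RectDiagram) (T : OType) : Prop :=
  ∃ θ₁ θ₂ φ₁ φ₂, ElemMoveData R₁ R₂ θ₁ θ₂ φ₁ φ₂ ∧
    R₂.verts.card = R₁.verts.card + 2 ∧ StabTypeData R₁ R₂ θ₁ θ₂ φ₁ φ₂ T

/-- A destabilization of oriented type `T` (the type is read off from the inverse
stabilization `R₂ ↦ R₁`). -/
def DestabOfType (R₁ R₂ : RectDiagram) (T : OType) : Prop :=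
  ∃ θ₁ θ₂ φ₁ φ₂, ElemMoveData R₁ R₂ θ₁ θ₂ φ₁ φ₂ ∧
    R₁.verts.card = R₂.verts.card + 2 ∧ StabTypeData R₂ R₁ θ₁ θ₂ φ₁ φ₂ T

/-- The union of staircase curves `Γ_→II(R)` on the torus. -/
def Gamma (R : RectDiagram) : Set Torus :=
  {p | ∃ θ₀ φ₁ φ₂, (θ₀, φ₁) ∈ R.pos ∧ (θ₀, φ₂) ∈ R.neg ∧ p.1 = θ₀ ∧ p.2 ∈ closedArc φ₁ φ₂} ∪
  {p | ∃ θ₁ θ₂ φ₀, (θ₁, φ₀) ∈ R.neg ∧ (θ₂, φ₀) ∈ R.pos ∧ p.2 = φ₀ ∧ p.1 ∈ closedArc θ₁ θ₂}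

/-- Number of intersection points of a subset of the torus with the meridian `{θ₀} × S¹`. -/
def merCount (A : Set Torus) (θ₀ : 𝕊) : ℕ := (A ∩ {p | p.1 = θ₀}).ncard

/-- Number of intersection points of a subset of the torus with the longitude `S¹ × {φ₀}`. -/
def lonCount (A : Set Torus) (φ₀ : 𝕊) : ℕ := (A ∩ {p | p.2 = φ₀}).ncard

/-- `(k,l)` is the homology class of `Γ_→II(R)` in `H₁(T²;ℤ)`: it counts the
intersections of `Γ_→II(R)` with generic meridians and longitudes respectively. -/
def IsHomClass (R : RectDiagram) (k l : ℕ) : Prop :=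
  (∀ θ₀ : 𝕊, θ₀ ∉ R.pθ → merCount (Gamma R) θ₀ = k) ∧
  (∀ φ₀ : 𝕊, φ₀ ∉ R.pφ → lonCount (Gamma R) φ₀ = l)

/-- `p` lies in the relative interior of a vertical segment of `Γ_→II(R)`. -/
def OnVertInt (R : RectDiagram) (p : Torus) : Prop :=
  ∃ θ₀ φ₁ φ₂, (θ₀, φ₁) ∈ R.pos ∧ (θ₀, φ₂) ∈ R.neg ∧ p.1 = θ₀ ∧ p.2 ∈ openArc φ₁ φ₂

/-- `p` lies in the relative interior of a horizontal segment of `Γ_→II(R)`. -/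
def OnHorizInt (R : RectDiagram) (p : Torus) : Prop :=
  ∃ θ₁ θ₂ φ₀, (θ₁, φ₀) ∈ R.neg ∧ (θ₂, φ₀) ∈ R.pos ∧ p.2 = φ₀ ∧ p.1 ∈ openArc θ₁ θ₂

/-- The set of double (self-intersection) points of `Γ_→II(R)`. -/
def DoublePts (R : RectDiagram) : Set Torus := {p | OnVertInt R p ∧ OnHorizInt R p}

/-- An exchange move or a type-`T` stabilization or destabilization. -/
def MoveOfType (T : OType) (R₁ R₂ : RectDiagram) : Prop :=
  ExchangeMove R₁ R₂ ∨ StabOfType R₁ R₂ T ∨ DestabOfType R₁ R₂ T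

/-- The equivalence generated by exchange moves and type-`T` (de)stabilizations:
`[R₁]_T = [R₂]_T`. -/
def EquivOfType (T : OType) : RectDiagram → RectDiagram → Prop :=
  Relation.ReflTransGen (MoveOfType T)

/-- An (ambient) isotopy of the torus: a continuous family of homeomorphisms
starting from the identity. -/
def Isotopy (H : ℝ → Torus ≃ₜ Torus) : Prop :=
  Continuous (fun q : ℝ × Torus => H q.1 q.2) ∧ H 0 = Homeomorph.refl Torus

/-- `A` is isotopic to `B` by an ambient isotopy of `T²` fixed on `X`. -/
def IsotopicRelFixed (A B X : Set Torus) : Prop :=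
  ∃ H : ℝ → Torus ≃ₜ Torus, Isotopy H ∧ (∀ t : ℝ, ∀ x ∈ X, H t x = x) ∧ (H 1) '' A = B

/-- `F` is an embedded closed disc in the torus. -/
def IsClosedDisc (F : Set Torus) : Prop :=
  Nonempty (↥F ≃ₜ ↥(Metric.closedBall (0 : ℝ × ℝ) 1))

/-- `F` is an embedded closed annulus in the torus. -/
def IsClosedAnnulus (F : Set Torus) : Prop :=
  Nonempty (↥F ≃ₜ (𝕊 × ↥(Set.Icc (0:ℝ) 1)))

/-- A self-homeomorphism of `S¹` is orientation-preserving if it preserves the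
cyclic order (sends points of open positively oriented arcs to points of the
corresponding open positively oriented arcs). -/
def OrientPres (f : 𝕊 ≃ₜ 𝕊) : Prop :=
  ∀ a b c : 𝕊, b ∈ openArc a c → f b ∈ openArc (f a) (f c)

/-- Combinatorial equivalence of rectangular diagrams: related by a product of
orientation-preserving self-homeomorphisms of the two circle factors. -/
def CombEquiv (R R' : RectDiagram) : Prop :=
  ∃ f g : 𝕊 ≃ₜ 𝕊, OrientPres f ∧ OrientPres g ∧
    (fun p : Torus => (f p.1, g p.2)) '' ↑R.pos = ↑R'.pos ∧
    (fun p : Torus => (f p.1, g p.2)) '' ↑R.neg = ↑R'.neg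

/-- `R` and `R'` have the same `→II`-homology type. -/
def SameHomType (R R' : RectDiagram) : Prop :=
  ∃ R'' : RectDiagram, CombEquiv R' R'' ∧
    IsotopicRelFixed (Gamma R) (Gamma R'') (DoublePts R)


/-! ### Strand systems -/

/-- A system of ordered, non-crossing monotone strands, in coordinates `s = θ + φ`, `x = θ`. -/
structure Strands (n k : ℤ) (x : ℤ → ℝ → ℝ) : Prop where
  mono_s : ∀ i s s', s ≤ s' → x i s ≤ x i s'
  lip : ∀ i s s', s ≤ s' → x i s' ≤ x i s + (s' - s)
  le_succ : ∀ i s, x i s ≤ x (i + 1) s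
  per_n : ∀ i s, x (i + n) s = x i s + 1
  per_k : ∀ i s, x (i - k) (s + 1) = x i s

namespace Strands

variable {n k : ℤ} {x x' : ℤ → ℝ → ℝ}

theorem cont (h : Strands n k x) (i : ℤ) : Continuous (x i) := by
  have : LipschitzWith 1 (x i) := by
    apply LipschitzWith.of_le_add
    intro s s'
    rcases le_total s s' with hs | hs
    · have := h.mono_s i s s' hs
      have := dist_nonneg (x := s) (y := s')
      linarith
    · have := h.lip i s' s hs
      rw [Real.dist_eq, abs_of_nonneg (by linarith)]
      linarith
  exact this.continuous

theorem mono (h : Strands n k x) (s : ℝ) : Monotone (fun i => x i s) :=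
  monotone_int_of_le_succ (fun i => h.le_succ i s)

theorem per_nb (h : Strands n k x) (b i : ℤ) (s : ℝ) : x (i + n * b) s = x i s + b := by
  induction b using Int.induction_on with
  | zero => simp
  | succ b ih =>
    have := h.per_n (i + n * b) s
    rw [show i + n * ((b : ℤ) + 1) = i + n * b + n by ring, this, ih]
    push_cast; ring
  | pred b ih =>
    have := h.per_n (i + n * (-(b : ℤ) - 1)) s
    rw [show i + n * (-(b : ℤ) - 1) + n = i + n * (-b) by ring, ih] at this
    push_cast at this ⊢
    linarith

theorem per_ka (h : Strands n k x) (a i : ℤ) (s : ℝ) : x (i - k * a) (s + a) = x i s := by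
  induction a using Int.induction_on with
  | zero => simp
  | succ a ih =>
    have := h.per_k (i - k * a) (s + ((a : ℤ) : ℝ))
    rw [← ih, ← this]
    congr 1
    · ring
    · push_cast; ring
  | pred a ih =>
    have := h.per_k (i - k * (-(a : ℤ) - 1)) (s + ((-(a : ℤ) - 1 : ℤ) : ℝ))
    rw [← ih, ← this]
    congr 1
    · ring
    · push_cast; ring

theorem per (h : Strands n k x) (a b i : ℤ) (s : ℝ) :
    x (i - k * a + n * b) (s + a) = x i s + b := by
  rw [h.per_nb, h.per_ka]

theorem comb (h : Strands n k x) (h' : Strands n k x') (t : ℝ) (h0 : 0 ≤ t) (h1 : t ≤ 1) :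
    Strands n k (fun i s => (1 - t) * x i s + t * x' i s) where
  mono_s i s s' hs := by
    have a := h.mono_s i s s' hs
    have b := h'.mono_s i s s' hs
    have : 0 ≤ 1 - t := by linarith
    gcongr
  lip i s s' hs := by
    have a := h.lip i s s' hs
    have b := h'.lip i s s' hs
    have : 0 ≤ 1 - t := by linarith
    calc (1 - t) * x i s' + t * x' i s'
        ≤ (1 - t) * (x i s + (s' - s)) + t * (x' i s + (s' - s)) := by gcongr
      _ = _ := by ring
  le_succ i s := by
    have a := h.le_succ i s
    have b := h'.le_succ i s
    have : 0 ≤ 1 - t := by linarith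
    gcongr
  per_n i s := by rw [h.per_n, h'.per_n]; ring
  per_k i s := by rw [h.per_k, h'.per_k]

end Strands

/-- Interpolated position between strands. -/
def ipos (x : ℤ → ℝ → ℝ) (z : ℤ × ℝ × ℝ) : ℝ :=
  (1 - z.2.2) * x z.1 z.2.1 + z.2.2 * x (z.1 + 1) z.2.1

/-- The point of the torus with interpolated position. -/
def qmap (x : ℤ → ℝ → ℝ) (z : ℤ × ℝ × ℝ) : Torus :=
  (((ipos x z : ℝ) : 𝕊), ((z.2.1 - ipos x z : ℝ) : 𝕊))

theorem circ_eq_iff (a b : ℝ) : (a : 𝕊) = (b : 𝕊) ↔ ∃ m : ℤ, a = b + m := by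
  rw [← sub_eq_zero, ← AddCircle.coe_sub, AddCircle.coe_eq_zero_iff]
  constructor
  · rintro ⟨m, hm⟩
    exact ⟨m, by simp at hm; linarith⟩
  · rintro ⟨m, hm⟩
    exact ⟨m, by simp; linarith⟩

/-- Two systems touch at the same places. -/
def Coinc (x x' : ℤ → ℝ → ℝ) : Prop :=
  ∀ i s, x i s = x (i + 1) s ↔ x' i s = x' (i + 1) s

theorem coinc_le {n k : ℤ} {x x' : ℤ → ℝ → ℝ} (h : Strands n k x) (_h' : Strands n k x')
    (hc : Coinc x x') (s : ℝ) (i : ℤ) (d : ℕ) (he : x i s = x (i + d) s) :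
    x' i s = x' (i + d) s := by
  induction d with
  | zero => simp
  | succ d ih =>
    have h1 : x i s ≤ x (i + d) s := h.mono s (by omega)
    have h2 : x (i + d) s ≤ x (i + d + 1) s := h.le_succ _ s
    push_cast at he ⊢
    rw [← add_assoc] at he ⊢
    rw [ih (by linarith)]
    exact (hc _ _).1 (by linarith)

theorem ipos_fiber_aux {n k : ℤ} {x x' : ℤ → ℝ → ℝ} (h : Strands n k x) (h' : Strands n k x')
    (hc : Coinc x x') (s : ℝ) (i j : ℤ) (u v : ℝ) (hu : u ∈ Icc (0:ℝ) 1) (hv : v ∈ Icc (0:ℝ) 1)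
    (hij : i ≤ j) (he : ipos x (i, s, u) = ipos x (j, s, v)) :
    ipos x' (i, s, u) = ipos x' (j, s, v) := by
  simp only [ipos] at he ⊢
  obtain ⟨hu0, hu1⟩ := hu
  obtain ⟨hv0, hv1⟩ := hv
  rcases eq_or_lt_of_le hij with rfl | hlt
  · have : (u - v) * (x (i + 1) s - x i s) = 0 := by linarith
    rcases mul_eq_zero.1 this with h1 | h1
    · rw [sub_eq_zero.1 h1]
    · have := (hc i s).1 (by linarith)
      rw [← this]; ring
  · have m1 := h.le_succ i s
    have m2 : x (i + 1) s ≤ x j s := h.mono s (by omega)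
    have m3 := h.le_succ j s
    have e1 : 0 ≤ (1 - u) * (x (i + 1) s - x i s) := mul_nonneg (by linarith) (by linarith)
    have e2 : 0 ≤ v * (x (j + 1) s - x j s) := mul_nonneg (by linarith) (by linarith)
    have f1 : (1 - u) * (x (i + 1) s - x i s) = 0 := by linarith
    have f2 : v * (x (j + 1) s - x j s) = 0 := by linarith
    have f3 : x (i + 1) s = x j s := by linarith
    have g3 : x' (i + 1) s = x' j s := by
      obtain ⟨d, rfl⟩ : ∃ d : ℕ, j = i + 1 + d := ⟨(j - (i + 1)).toNat, by omega⟩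
      exact coinc_le h h' hc s _ d f3
    have g1 : (1 - u) * (x' (i + 1) s - x' i s) = 0 := by
      rcases mul_eq_zero.1 f1 with f | f
      · rw [f]; ring
      · rw [← (hc i s).1 (by linarith)]; ring
    have g2 : v * (x' (j + 1) s - x' j s) = 0 := by
      rcases mul_eq_zero.1 f2 with f | f
      · rw [f]; ring
      · rw [← (hc j s).1 (by linarith)]; ring
    linarith

theorem ipos_fiber {n k : ℤ} {x x' : ℤ → ℝ → ℝ} (h : Strands n k x) (h' : Strands n k x')
    (hc : Coinc x x') (s : ℝ) (i j : ℤ) (u v : ℝ) (hu : u ∈ Icc (0:ℝ) 1) (hv : v ∈ Icc (0:ℝ) 1)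
    (he : ipos x (i, s, u) = ipos x (j, s, v)) :
    ipos x' (i, s, u) = ipos x' (j, s, v) := by
  rcases le_total i j with hij | hij
  · exact ipos_fiber_aux h h' hc s i j u v hu hv hij he
  · exact (ipos_fiber_aux h h' hc s j i v u hv hu hij he.symm).symm

theorem ipos_per {n k : ℤ} {x : ℤ → ℝ → ℝ} (h : Strands n k x) (a b i : ℤ) (s u : ℝ) :
    ipos x (i - k * a + n * b, s + a, u) = ipos x (i, s, u) + b := by
  simp only [ipos]
  rw [h.per, show i - k * a + n * b + 1 = (i + 1) - k * a + n * b by ring, h.per]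
  ring

theorem qmap_fiber {n k : ℤ} {x x' : ℤ → ℝ → ℝ} (h : Strands n k x) (h' : Strands n k x')
    (hc : Coinc x x') (z w : ℤ × ℝ × ℝ) (hz : z.2.2 ∈ Icc (0:ℝ) 1) (hw : w.2.2 ∈ Icc (0:ℝ) 1)
    (he : qmap x z = qmap x w) : qmap x' z = qmap x' w := by
  obtain ⟨i, s, u⟩ := z
  obtain ⟨j, s', v⟩ := w
  simp only [qmap, Prod.mk.injEq, circ_eq_iff] at he ⊢
  obtain ⟨⟨b, hb⟩, ⟨c, hc'⟩⟩ := he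
  have hs : s = s' + ((b + c : ℤ) : ℝ) := by push_cast; linarith
  subst hs
  have := ipos_per h (b + c) b j s' v
  have key : ipos x (i, s' + ((b + c : ℤ) : ℝ), u)
      = ipos x (j - k * (b + c) + n * b, s' + ((b + c : ℤ) : ℝ), v) := by
    rw [this]; exact hb
  have key' := ipos_fiber h h' hc _ _ _ _ _ hz hw key
  rw [ipos_per h'] at key'
  refine ⟨⟨b, key'⟩, ⟨c, ?_⟩⟩
  rw [key']; push_cast; ring

/-- A compact fundamental piece. -/
def Kset (n : ℤ) : Set (ℤ × ℝ × ℝ) := Icc 0 n ×ˢ (Icc (0:ℝ) 1 ×ˢ Icc (0:ℝ) 1)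

theorem Kset_compact (n : ℤ) : IsCompact (Kset n) :=
  ((Set.finite_Icc 0 n).isCompact).prod (isCompact_Icc.prod isCompact_Icc)

theorem qmap_surj {n k : ℤ} (hn : 0 < n) {x : ℤ → ℝ → ℝ} (h : Strands n k x) (p : Torus) :
    ∃ z ∈ Kset n, qmap x z = p := by
  obtain ⟨p1, p2⟩ := p
  obtain ⟨θ, rfl⟩ := QuotientAddGroup.mk_surjective p1
  obtain ⟨φ, rfl⟩ := QuotientAddGroup.mk_surjective p2
  set s := Int.fract (θ + φ) with hs
  set θ' := θ - ⌊θ - x 0 s⌋ with hθ'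
  have a1 : x 0 s ≤ θ' := by have := Int.floor_le (θ - x 0 s); linarith
  have a2 : θ' < x n s := by
    have := Int.lt_floor_add_one (θ - x 0 s)
    have := h.per_n 0 s
    rw [zero_add] at this
    linarith
  obtain ⟨i, hi, hmax⟩ := Int.exists_greatest_of_bdd (P := fun i => x i s ≤ θ')
    ⟨n, fun i hi => by
      by_contra hlt
      have : x n s ≤ x i s := h.mono s (by omega)
      linarith⟩ ⟨0, a1⟩
  have i0 : 0 ≤ i := hmax 0 a1
  have hin : i ≤ n := by
    by_contra hlt
    have : x n s ≤ x i s := h.mono s (by omega)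
    linarith
  have hlt : θ' < x (i + 1) s := by
    by_contra hle
    have := hmax (i + 1) (not_lt.1 hle)
    omega
  have hpos : 0 < x (i + 1) s - x i s := by linarith
  refine ⟨(i, s, (θ' - x i s) / (x (i + 1) s - x i s)), ⟨⟨i0, hin⟩,
    ⟨Int.fract_nonneg _, (Int.fract_lt_one _).le⟩, ⟨by apply div_nonneg <;> linarith, ?_⟩⟩, ?_⟩
  · show (θ' - x i s) / (x (i + 1) s - x i s) ≤ 1
    rw [div_le_one hpos]; linarith
  · have e : ipos x (i, s, (θ' - x i s) / (x (i + 1) s - x i s)) = θ' := by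
      simp only [ipos]; field_simp; ring
    simp only [qmap, e]
    refine Prod.ext ?_ ?_
    · exact (circ_eq_iff _ _).2 ⟨-⌊θ - x 0 s⌋, by push_cast; linarith⟩
    · refine (circ_eq_iff _ _).2 ⟨-⌊θ + φ⌋ + ⌊θ - x 0 s⌋, ?_⟩
      simp only [hs, Int.fract, hθ']; push_cast; ring

theorem ipos_cont {n k : ℤ} {x : ℤ → ℝ → ℝ} (h : Strands n k x) :
    Continuous (ipos x) := by
  have : Continuous (fun z : ℤ × (ℝ × ℝ) => ipos x z) := by
    rw [continuous_prod_of_discrete_left]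
    intro i
    simp only [ipos]
    have := h.cont i
    have := h.cont (i + 1)
    fun_prop
  exact this

theorem qmap_cont {n k : ℤ} {x : ℤ → ℝ → ℝ} (h : Strands n k x) :
    Continuous (qmap x) := by
  have := ipos_cont h
  have c : Continuous (fun r : ℝ => (r : 𝕊)) := AddCircle.continuous_mk' 1
  unfold qmap
  fun_prop

/-- The transport map between coincident systems. -/
def tmap {n k : ℤ} (hn : 0 < n) {x : ℤ → ℝ → ℝ} (h : Strands n k x) (x' : ℤ → ℝ → ℝ)
    (p : Torus) : Torus := qmap x' (qmap_surj hn h p).choose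

theorem tmap_qmap {n k : ℤ} (hn : 0 < n) {x x' : ℤ → ℝ → ℝ} (h : Strands n k x)
    (h' : Strands n k x') (hc : Coinc x x') (z : ℤ × ℝ × ℝ) (hz : z.2.2 ∈ Icc (0:ℝ) 1) :
    tmap hn h x' (qmap x z) = qmap x' z := by
  have := (qmap_surj hn h (qmap x z)).choose_spec
  exact qmap_fiber h h' hc _ _ this.1.2.2 hz this.2

theorem Coinc.symm {x x' : ℤ → ℝ → ℝ} (hc : Coinc x x') : Coinc x' x :=
  fun i s => (hc i s).symm

theorem tmap_inv {n k : ℤ} (hn : 0 < n) {x x' : ℤ → ℝ → ℝ} (h : Strands n k x)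
    (h' : Strands n k x') (hc : Coinc x x') (p : Torus) :
    tmap hn h' x (tmap hn h x' p) = p := by
  obtain ⟨z, hz, rfl⟩ := qmap_surj hn h p
  rw [tmap_qmap hn h h' hc z hz.2.2, tmap_qmap hn h' h hc.symm z hz.2.2]

theorem coinc_comb {n k : ℤ} {x x' : ℤ → ℝ → ℝ} (h : Strands n k x)
    (h' : Strands n k x') (hc : Coinc x x') (t : ℝ) (h0 : 0 ≤ t) (h1 : t ≤ 1) :
    Coinc x (fun i s => (1 - t) * x i s + t * x' i s) := by
  intro i s
  dsimp only
  constructor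
  · intro he
    rw [← he, ← (hc i s).1 he]
  · intro he
    have a := h.le_succ i s
    have b := h'.le_succ i s
    have a' : 0 ≤ (1 - t) * (x (i + 1) s - x i s) := mul_nonneg (by linarith) (by linarith)
    have b' : 0 ≤ t * (x' (i + 1) s - x' i s) := mul_nonneg (by linarith) (by linarith)
    rcases mul_eq_zero.1 (show (1 - t) * (x (i + 1) s - x i s) = 0 by linarith) with e | e
    · refine (hc i s).2 ?_
      have : t = 1 := by linarith
      subst this
      linarith
    · linarith

theorem tmap_joint {n k : ℤ} (hn : 0 < n) {x x' : ℤ → ℝ → ℝ} (h : Strands n k x)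
    (h' : Strands n k x') (hc : Coinc x x') :
    Continuous (fun q : (Icc (0:ℝ) 1) × Torus =>
      tmap hn h (fun i s => (1 - q.1.1) * x i s + q.1.1 * x' i s) q.2) := by
  have : CompactSpace (Kset n) := isCompact_iff_compactSpace.1 (Kset_compact n)
  let Φ : (Icc (0:ℝ) 1) × Kset n → (Icc (0:ℝ) 1) × Torus := fun q => (q.1, qmap x q.2.1)
  have hΦc : Continuous Φ := by
    have := qmap_cont h
    fun_prop
  have hΦs : Function.Surjective Φ := by
    rintro ⟨t, p⟩
    obtain ⟨z, hz, rfl⟩ := qmap_surj hn h p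
    exact ⟨(t, ⟨z, hz⟩), rfl⟩
  have hq : Topology.IsQuotientMap Φ := hΦc.isClosedMap.isQuotientMap hΦc hΦs
  rw [hq.continuous_iff]
  have : (fun q : (Icc (0:ℝ) 1) × Torus =>
      tmap hn h (fun i s => (1 - q.1.1) * x i s + q.1.1 * x' i s) q.2) ∘ Φ
      = fun q => ((((1 - q.1.1) * ipos x q.2.1 + q.1.1 * ipos x' q.2.1 : ℝ) : 𝕊),
          ((q.2.1.2.1 - ((1 - q.1.1) * ipos x q.2.1 + q.1.1 * ipos x' q.2.1) : ℝ) : 𝕊)) := by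
    funext q
    obtain ⟨⟨t, ht⟩, ⟨z, hz⟩⟩ := q
    show tmap hn h (fun i s => (1 - t) * x i s + t * x' i s) (qmap x z) = _
    rw [tmap_qmap hn h (h.comb h' t ht.1 ht.2) (coinc_comb h h' hc t ht.1 ht.2) z hz.2.2]
    have : ipos (fun i s => (1 - t) * x i s + t * x' i s) z
        = (1 - t) * ipos x z + t * ipos x' z := by
      simp only [ipos]; ring
    simp only [qmap, this]
  rw [this]
  have c1 := ipos_cont h
  have c2 := ipos_cont h'
  have c : Continuous (fun r : ℝ => (r : 𝕊)) := AddCircle.continuous_mk' 1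
  fun_prop

/-- The point of the torus on strand `i` at level `s`. -/
def spt (x : ℤ → ℝ → ℝ) (i : ℤ) (s : ℝ) : Torus := ((x i s : 𝕊), ((s - x i s : ℝ) : 𝕊))

theorem spt_eq (x : ℤ → ℝ → ℝ) (i : ℤ) (s : ℝ) : spt x i s = qmap x (i, s, 0) := by
  simp [spt, qmap, ipos]

theorem isotopic_of_strands {n k : ℤ} (hn : 0 < n) {x x' : ℤ → ℝ → ℝ} (h : Strands n k x)
    (h' : Strands n k x') (hc : Coinc x x') (A B X : Set Torus)
    (hA : A = {p | ∃ i s, spt x i s = p}) (hB : B = {p | ∃ i s, spt x' i s = p})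
    (hX : ∀ p ∈ X, ∃ i s, spt x i s = p ∧ x i s = x' i s) : IsotopicRelFixed A B X := by
  let τ : ℝ → Icc (0:ℝ) 1 := projIcc 0 1 zero_le_one
  let xt : Icc (0:ℝ) 1 → ℤ → ℝ → ℝ := fun t i s => (1 - t.1) * x i s + t.1 * x' i s
  have hs : ∀ t, Strands n k (xt t) := fun t => h.comb h' t.1 t.2.1 t.2.2
  have hcc : ∀ t, Coinc x (xt t) := fun t => coinc_comb h h' hc t.1 t.2.1 t.2.2
  have hj := tmap_joint hn h h' hc
  let E : Icc (0:ℝ) 1 → Torus ≃ Torus := fun t =>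
    { toFun := tmap hn h (xt t)
      invFun := tmap hn (hs t) x
      left_inv := tmap_inv hn h (hs t) (hcc t)
      right_inv := tmap_inv hn (hs t) h (hcc t).symm }
  have hE : ∀ t, Continuous (E t) := fun t => by
    show Continuous (tmap hn h (xt t))
    exact hj.comp (Continuous.prodMk_right t)
  let H : ℝ → Torus ≃ₜ Torus := fun t => (hE (τ t)).homeoOfEquivCompactToT2
  have hH : ∀ t p, H t p = tmap hn h (xt (τ t)) p := fun t p => rfl
  have hHs : ∀ t i s, H t (spt x i s) = spt (xt (τ t)) i s := fun t i s => by
    rw [hH, spt_eq, spt_eq]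
    exact tmap_qmap hn h (hs _) (hcc _) _ (by simp)
  have x0 : xt (τ 0) = x := by
    have : τ 0 = ⟨0, by simp⟩ := projIcc_left _
    funext i s; simp [xt, this]
  have x1 : xt (τ 1) = x' := by
    have : τ 1 = ⟨1, by simp⟩ := projIcc_right _
    funext i s; simp [xt, this]
  refine ⟨H, ⟨?_, ?_⟩, ?_, ?_⟩
  · have : Continuous (fun q : ℝ × Torus => ((τ q.1, q.2) : Icc (0:ℝ) 1 × Torus)) := by
      have : Continuous τ := continuous_projIcc
      fun_prop
    exact hj.comp this
  · ext1 p
    rw [hH, x0]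
    obtain ⟨z, hz, rfl⟩ := qmap_surj hn h p
    exact tmap_qmap hn h h (fun _ _ => Iff.rfl) z hz.2.2
  · intro t p hp
    obtain ⟨i, s, rfl, he⟩ := hX p hp
    rw [hHs]
    have : xt (τ t) i s = x i s := by simp only [xt, ← he]; ring
    simp only [spt, this]
  · rw [hA, hB]
    ext p
    constructor
    · rintro ⟨_, ⟨i, s, rfl⟩, rfl⟩
      exact ⟨i, s, by rw [hHs, x1]⟩
    · rintro ⟨i, s, rfl⟩
      exact ⟨_, ⟨i, s, rfl⟩, by rw [hHs, x1]⟩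

/-! ### Height functions and their level strands -/

/-- Integer-valued height functions on the universal cover of the torus. -/
structure Height (k l : ℤ) (h : ℝ → ℝ → ℤ) : Prop where
  mono : ∀ a b φ, a ≤ b → h a φ ≤ h b φ
  anti : ∀ θ a b, a ≤ b → h θ b ≤ h θ a
  per_θ : ∀ θ φ, h (θ + 1) φ = h θ φ + l
  per_φ : ∀ θ φ, h θ (φ + 1) = h θ φ - k

/-- Level strands of a height function. -/
def xs (h : ℝ → ℝ → ℤ) (i : ℤ) (s : ℝ) : ℝ := sInf {x | i ≤ h x (s - x)}

namespace Height

variable {k l : ℤ} {h : ℝ → ℝ → ℤ}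

theorem diag (H : Height k l h) (s a b : ℝ) (hab : a ≤ b) : h a (s - a) ≤ h b (s - b) :=
  (H.mono a b _ hab).trans (H.anti b _ _ (by linarith))

theorem diag_per (H : Height k l h) (s a : ℝ) (b : ℤ) :
    h (a + b) (s - (a + b)) = h a (s - a) + (k + l) * b := by
  induction b using Int.induction_on with
  | zero => simp
  | succ b ih =>
    have e1 := H.per_θ (a + ((b : ℤ) : ℝ)) (s - (a + ((b : ℤ) : ℝ)) - 1)
    have e2 := H.per_φ (a + ((b : ℤ) : ℝ)) (s - (a + ((b : ℤ) : ℝ)) - 1)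
    rw [sub_add_cancel, ih] at e2
    rw [show a + (((b : ℤ) + 1 : ℤ) : ℝ) = a + ((b : ℤ) : ℝ) + 1 by push_cast; ring,
      show s - (a + ((b : ℤ) : ℝ) + 1) = s - (a + ((b : ℤ) : ℝ)) - 1 by ring, e1]
    linarith
  | pred b ih =>
    have e1 := H.per_θ (a + ((-(b : ℤ) - 1 : ℤ) : ℝ)) (s - (a + ((-(b : ℤ) : ℤ) : ℝ)))
    have e2 := H.per_φ (a + ((-(b : ℤ) - 1 : ℤ) : ℝ)) (s - (a + ((-(b : ℤ) : ℤ) : ℝ)))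
    rw [show a + ((-(b : ℤ) - 1 : ℤ) : ℝ) + 1 = a + ((-(b : ℤ) : ℤ) : ℝ) by push_cast; ring,
      ih] at e1
    rw [show s - (a + ((-(b : ℤ) : ℤ) : ℝ)) + 1 = s - (a + ((-(b : ℤ) - 1 : ℤ) : ℝ)) by
      push_cast; ring] at e2
    rw [e2]
    linarith

theorem set_ne (H : Height k l h) (hn : 0 < k + l) (i : ℤ) (s : ℝ) :
    {x | i ≤ h x (s - x)}.Nonempty := by
  refine ⟨0 + ((|i - h 0 (s - 0)| : ℤ) : ℝ), ?_⟩
  rw [mem_ofPred_eq, H.diag_per]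
  have := le_abs_self (i - h 0 (s - 0))
  have := abs_nonneg (i - h 0 (s - 0))
  nlinarith

theorem set_bdd (H : Height k l h) (hn : 0 < k + l) (i : ℤ) (s : ℝ) :
    BddBelow {x | i ≤ h x (s - x)} := by
  refine ⟨0 + ((-|i - h 0 (s - 0)| - 1 : ℤ) : ℝ), fun x hx => ?_⟩
  rw [mem_ofPred_eq] at hx
  by_contra hlt
  have h1 := H.diag s x _ (not_le.1 hlt).le
  rw [H.diag_per] at h1
  have := neg_abs_le (i - h 0 (s - 0))
  have := abs_nonneg (i - h 0 (s - 0))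
  nlinarith

theorem lt_of_lt_xs (H : Height k l h) (hn : 0 < k + l) {i : ℤ} {s x : ℝ} (hx : x < xs h i s) :
    h x (s - x) < i := by
  by_contra hle
  have : xs h i s ≤ x := csInf_le (H.set_bdd hn i s) (not_lt.1 hle)
  linarith

theorem le_of_xs_lt (H : Height k l h) (hn : 0 < k + l) {i : ℤ} {s x : ℝ} (hx : xs h i s < x) :
    i ≤ h x (s - x) := by
  obtain ⟨y, hy, hyx⟩ := exists_lt_of_csInf_lt (H.set_ne hn i s) hx
  exact le_trans hy (H.diag s y x hyx.le)

theorem xs_eq (H : Height k l h) (hn : 0 < k + l) {i : ℤ} {s z : ℝ}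
    (h1 : ∀ x < z, h x (s - x) < i) (h2 : ∀ x, z < x → i ≤ h x (s - x)) : xs h i s = z := by
  rcases lt_trichotomy (xs h i s) z with hlt | he | hlt
  · obtain ⟨y, hy1, hy2⟩ := exists_between hlt
    have := h1 y hy2
    have := H.le_of_xs_lt hn hy1
    omega
  · exact he
  · obtain ⟨y, hy1, hy2⟩ := exists_between hlt
    have := h2 y hy1
    have := H.lt_of_lt_xs hn hy2
    omega

theorem xs_le_xs (H : Height k l h) (hn : 0 < k + l) {i j : ℤ} {s s' c : ℝ}
    (hh : ∀ x, j ≤ h x (s' - x) → i ≤ h (x + c) (s - (x + c))) : xs h i s ≤ xs h j s' + c := by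
  by_contra hlt
  obtain ⟨y, hy1, hy2⟩ := exists_between (not_le.1 hlt)
  have a := H.lt_of_lt_xs hn hy2
  have b := hh (y - c) (H.le_of_xs_lt hn (by linarith))
  rw [sub_add_cancel] at b
  omega

theorem strands (H : Height k l h) (hn : 0 < k + l) : Strands (k + l) k (xs h) where
  mono_s i s s' hs := by
    have := H.xs_le_xs (i := i) (j := i) (s := s) (s' := s') (c := 0) hn (fun x hx => by
      rw [add_zero]; exact hx.trans (H.anti x _ _ (by linarith)))
    linarith
  lip i s s' hs := by
    refine H.xs_le_xs hn (fun x hx => ?_)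
    rw [show s' - (x + (s' - s)) = s - x by ring]
    exact hx.trans (H.mono _ _ _ (by linarith))
  le_succ i s := by
    have := H.xs_le_xs (i := i) (j := i + 1) (s := s) (s' := s) (c := 0) hn (fun x hx => by
      rw [add_zero]; omega)
    linarith
  per_n i s := by
    refine H.xs_eq hn (fun x hx => ?_) (fun x hx => ?_)
    · have := H.lt_of_lt_xs hn (show x - 1 < xs h i s by linarith)
      have e := H.diag_per s (x - 1) 1
      simp only [Int.cast_one, sub_add_cancel] at e
      omega
    · have := H.le_of_xs_lt hn (show xs h i s < x - 1 by linarith)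
      have e := H.diag_per s (x - 1) 1
      simp only [Int.cast_one, sub_add_cancel] at e
      omega
  per_k i s := by
    refine H.xs_eq hn (fun x hx => ?_) (fun x hx => ?_)
    · have := H.lt_of_lt_xs hn hx
      have e := H.per_φ x (s - x)
      rw [show s - x + 1 = s + 1 - x by ring] at e
      omega
    · have := H.le_of_xs_lt hn hx
      have e := H.per_φ x (s - x)
      rw [show s - x + 1 = s + 1 - x by ring] at e
      omega

open Filter Topology in
theorem xs_iff (H : Height k l h) (hn : 0 < k + l) {θ φ : ℝ} {L U : ℤ}
    (hL : ∀ᶠ δ in 𝓝[>] (0:ℝ), h (θ - δ) (φ + δ) = L)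
    (hU : ∀ᶠ δ in 𝓝[>] (0:ℝ), h (θ + δ) (φ - δ) = U) (i : ℤ) :
    xs h i (θ + φ) = θ ↔ L < i ∧ i ≤ U := by
  have small : ∀ ε : ℝ, 0 < ε → ∀ᶠ δ in 𝓝[>] (0:ℝ), 0 < δ ∧ δ < ε := fun ε hε =>
    Ioo_mem_nhdsGT hε
  constructor
  · intro he
    obtain ⟨δ, ⟨⟨e1, e2⟩, hδ, _⟩⟩ := ((hL.and hU).and (small 1 one_pos)).exists
    constructor
    · have := H.lt_of_lt_xs hn (i := i) (s := θ + φ) (x := θ - δ) (by linarith)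
      rwa [show θ + φ - (θ - δ) = φ + δ by ring, e1] at this
    · have := H.le_of_xs_lt hn (i := i) (s := θ + φ) (x := θ + δ) (by linarith)
      rwa [show θ + φ - (θ + δ) = φ - δ by ring, e2] at this
  · rintro ⟨h1, h2⟩
    refine H.xs_eq hn (fun x hx => ?_) (fun x hx => ?_)
    · obtain ⟨δ, e1, hδ, hlt⟩ := (hL.and (small (θ - x) (by linarith))).exists
      have := H.diag (θ + φ) x (θ - δ) (by linarith)
      rw [show θ + φ - (θ - δ) = φ + δ by ring, e1] at this
      omega
    · obtain ⟨δ, e1, hδ, hlt⟩ := (hU.and (small (x - θ) (by linarith))).exists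
      have := H.diag (θ + φ) (θ + δ) x (by linarith)
      rw [show θ + φ - (θ + δ) = φ - δ by ring, e1] at this
      omega

end Height

/-! ### Circle arithmetic -/

theorem toIco_coe (y : ℝ) : toIco (y : 𝕊) = Int.fract y := by
  have := AddCircle.coe_equivIco_mk_apply (p := (1:ℝ)) y
  simpa [toIco] using this

theorem coe_toIco (a : 𝕊) : ((toIco a : ℝ) : 𝕊) = a := by
  obtain ⟨y, rfl⟩ := QuotientAddGroup.mk_surjective a
  have : toIco (QuotientAddGroup.mk y : 𝕊) = Int.fract y := toIco_coe y
  rw [this]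
  exact (circ_eq_iff _ _).2 ⟨-⌊y⌋, by push_cast; rw [Int.fract]; ring⟩

theorem toIco_nonneg (a : 𝕊) : 0 ≤ toIco a := by
  rw [← coe_toIco a, toIco_coe]; exact Int.fract_nonneg _

theorem toIco_lt_one (a : 𝕊) : toIco a < 1 := by
  rw [← coe_toIco a, toIco_coe]; exact Int.fract_lt_one _

theorem toIco_inj {a b : 𝕊} (h : toIco a = toIco b) : a = b := by
  rw [← coe_toIco a, h, coe_toIco]

theorem toIco_zero : toIco (0 : 𝕊) = 0 := by
  have := toIco_coe 0
  simpa using this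

theorem toIco_pos {a b : 𝕊} (h : a ≠ b) : 0 < toIco (a - b) := by
  refine lt_of_le_of_ne (toIco_nonneg _) (fun h0 => h ?_)
  rw [← toIco_zero] at h0
  exact sub_eq_zero.1 (toIco_inj h0.symm)

theorem toIco_sub_coe (y : ℝ) (a : 𝕊) : toIco ((y : 𝕊) - a) = Int.fract (y - toIco a) := by
  conv_lhs => rw [← coe_toIco a, ← AddCircle.coe_sub]
  rw [toIco_coe]

theorem toIco_sub (b a : 𝕊) :
    toIco (b - a) = toIco b - toIco a + if toIco b < toIco a then 1 else 0 := by
  conv_lhs => rw [← coe_toIco b, toIco_sub_coe]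
  have := toIco_nonneg a
  have := toIco_nonneg b
  have := toIco_lt_one a
  have := toIco_lt_one b
  rw [Int.fract_eq_iff]
  split_ifs with h
  · exact ⟨by linarith, by linarith, -1, by push_cast; ring⟩
  · exact ⟨by linarith, by linarith, 0, by push_cast; ring⟩

/-- Indicator of the half-open arc `[a;b)`, as a difference of floors. -/
def chi (a b : 𝕊) (y : ℝ) : ℤ :=
  ⌊y - toIco a⌋ - ⌊y - toIco b⌋ + if toIco b < toIco a then 1 else 0

theorem chi_eq (a b : 𝕊) (y : ℝ) :
    chi a b y = if toIco ((y : 𝕊) - a) < toIco (b - a) then 1 else 0 := by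
  rw [toIco_sub_coe, toIco_sub, chi]
  have := toIco_nonneg a
  have := toIco_nonneg b
  have := toIco_lt_one a
  have := toIco_lt_one b
  have f0 := Int.fract_nonneg (y - toIco a)
  have f1 := Int.fract_lt_one (y - toIco a)
  have f2 := Int.floor_add_fract (y - toIco a)
  set N := ⌊y - toIco a⌋
  set f := Int.fract (y - toIco a)
  by_cases h : toIco b < toIco a <;> simp only [h, if_true, if_false]
  · split_ifs with h2
    · have : ⌊y - toIco b⌋ = N := by
        rw [Int.floor_eq_iff]; constructor <;> linarith
      omega
    · have : ⌊y - toIco b⌋ = N + 1 := by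
        rw [Int.floor_eq_iff]; push_cast; constructor <;> linarith
      omega
  · split_ifs with h2
    · have : ⌊y - toIco b⌋ = N - 1 := by
        rw [Int.floor_eq_iff]; push_cast; constructor <;> linarith
      omega
    · have : ⌊y - toIco b⌋ = N := by
        rw [Int.floor_eq_iff]; constructor <;> linarith
      omega

theorem chi_nonneg (a b : 𝕊) (y : ℝ) : 0 ≤ chi a b y := by
  rw [chi_eq]; split_ifs <;> norm_num

theorem chi_per (a b : 𝕊) (y : ℝ) : chi a b (y + 1) = chi a b y := by
  rw [chi_eq, chi_eq]
  have : ((y + 1 : ℝ) : 𝕊) = (y : 𝕊) := (circ_eq_iff _ _).2 ⟨1, by simp⟩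
  rw [this]

theorem jump_eq (y : ℝ) (a : 𝕊) :
    ⌊y - toIco a⌋ - (⌈y - toIco a⌉ - 1) = if (y : 𝕊) = a then 1 else 0 := by
  split_ifs with h
  · rw [← coe_toIco a, circ_eq_iff] at h
    obtain ⟨m, hm⟩ := h
    rw [show y - toIco a = (m : ℝ) by linarith]
    simp
  · have : ⌈y - toIco a⌉ = ⌊y - toIco a⌋ + 1 := by
      rw [Int.ceil_eq_iff]
      push_cast
      refine ⟨?_, (Int.lt_floor_add_one _).le⟩
      rw [add_sub_cancel_right]
      refine lt_of_le_of_ne (Int.floor_le _) (fun he => h ?_)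
      rw [← coe_toIco a, circ_eq_iff]
      exact ⟨⌊y - toIco a⌋, by linarith⟩
    omega

open Filter Topology in
theorem ev_floor_add (y c : ℝ) : ∀ᶠ δ in 𝓝[>] (0:ℝ), ⌊y + δ - c⌋ = ⌊y - c⌋ := by
  have h1 := Int.lt_floor_add_one (y - c)
  have h2 := Int.floor_le (y - c)
  filter_upwards [Ioo_mem_nhdsGT (show (0:ℝ) < ⌊y - c⌋ + 1 - (y - c) by linarith)] with δ hδ
  rw [Int.floor_eq_iff]
  constructor <;> linarith [hδ.1, hδ.2]

open Filter Topology in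
theorem ev_floor_sub (y c : ℝ) : ∀ᶠ δ in 𝓝[>] (0:ℝ), ⌊y - δ - c⌋ = ⌈y - c⌉ - 1 := by
  have h1 := Int.ceil_lt_add_one (y - c)
  have h2 := Int.le_ceil (y - c)
  filter_upwards [Ioo_mem_nhdsGT (show (0:ℝ) < (y - c) - (⌈y - c⌉ - 1) by linarith)] with δ hδ
  rw [Int.floor_eq_iff]
  push_cast
  constructor <;> linarith [hδ.1, hδ.2]

open Filter Topology in
theorem ev_chi (a b : 𝕊) (y : ℝ) : ∀ᶠ δ in 𝓝[>] (0:ℝ), chi a b (y + δ) = chi a b y := by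
  filter_upwards [ev_floor_add y (toIco a), ev_floor_add y (toIco b)] with δ h1 h2
  simp only [chi, h1, h2]

/-! ### The height function of a rectangular diagram -/

/-- `vn v`, `hn v` are the negative vertices sharing a vertical (horizontal) edge with `v`. -/
structure Partners (R : RectDiagram) (vn hn : Torus → Torus) : Prop where
  vn_mem : ∀ v ∈ R.pos, vn v ∈ R.neg
  vn_fst : ∀ v ∈ R.pos, (vn v).1 = v.1
  hn_mem : ∀ v ∈ R.pos, hn v ∈ R.neg
  hn_snd : ∀ v ∈ R.pos, (hn v).2 = v.2

theorem exists_partners (R : RectDiagram) : ∃ vn hn, Partners R vn hn := by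
  have h1 : ∀ v ∈ R.pos, ∃ w, w ∈ R.neg ∧ w.1 = v.1 := fun v hv => by
    have : v.1 ∈ R.pos.image Prod.fst := Finset.mem_image_of_mem _ hv
    rw [R.thetaEq] at this
    simpa using Finset.mem_image.1 this
  have h2 : ∀ v ∈ R.pos, ∃ w, w ∈ R.neg ∧ w.2 = v.2 := fun v hv => by
    have : v.2 ∈ R.pos.image Prod.snd := Finset.mem_image_of_mem _ hv
    rw [R.phiEq] at this
    simpa using Finset.mem_image.1 this
  choose! vn hvn using h1
  choose! hn hhn using h2
  exact ⟨vn, hn, fun v hv => (hvn v hv).1, fun v hv => (hvn v hv).2,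
    fun v hv => (hhn v hv).1, fun v hv => (hhn v hv).2⟩

namespace Partners

variable {R : RectDiagram} {vn hn : Torus → Torus}

theorem ne {v w : Torus} (hv : v ∈ R.pos) (hw : w ∈ R.neg) : v ≠ w := fun h =>
  Finset.disjoint_left.1 R.disj hv (h ▸ hw)

theorem vn_eq (P : Partners R vn hn) {v w : Torus} (hv : v ∈ R.pos) (hw : w ∈ R.neg)
    (h : v.1 = w.1) : vn v = w :=
  R.thetaInjNeg (P.vn_mem v hv) hw ((P.vn_fst v hv).trans h)

theorem hn_eq (P : Partners R vn hn) {v w : Torus} (hv : v ∈ R.pos) (hw : w ∈ R.neg)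
    (h : v.2 = w.2) : hn v = w :=
  R.phiInjNeg (P.hn_mem v hv) hw ((P.hn_snd v hv).trans h)

theorem exists_vn (P : Partners R vn hn) {w : Torus} (hw : w ∈ R.neg) :
    ∃ v ∈ R.pos, vn v = w := by
  have : w.1 ∈ R.neg.image Prod.fst := Finset.mem_image_of_mem _ hw
  rw [← R.thetaEq] at this
  obtain ⟨v, hv, e⟩ := Finset.mem_image.1 this
  exact ⟨v, hv, P.vn_eq hv hw e⟩

theorem exists_hn (P : Partners R vn hn) {w : Torus} (hw : w ∈ R.neg) :
    ∃ v ∈ R.pos, hn v = w := by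
  have : w.2 ∈ R.neg.image Prod.snd := Finset.mem_image_of_mem _ hw
  rw [← R.phiEq] at this
  obtain ⟨v, hv, e⟩ := Finset.mem_image.1 this
  exact ⟨v, hv, P.hn_eq hv hw e⟩

theorem sum_vn (P : Partners R vn hn) (g : Torus → ℤ) :
    ∑ v ∈ R.pos, g (vn v) = ∑ w ∈ R.neg, g w := by
  refine Finset.sum_nbij vn P.vn_mem ?_ ?_ (fun _ _ => rfl)
  · intro v hv w hw h
    refine R.thetaInjPos hv hw ?_
    rw [← P.vn_fst v hv, ← P.vn_fst w hw, h]
  · intro w hw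
    obtain ⟨v, hv, e⟩ := P.exists_vn hw
    exact ⟨v, hv, e⟩

theorem sum_hn (P : Partners R vn hn) (g : Torus → ℤ) :
    ∑ v ∈ R.pos, g (hn v) = ∑ w ∈ R.neg, g w := by
  refine Finset.sum_nbij hn P.hn_mem ?_ ?_ (fun _ _ => rfl)
  · intro v hv w hw h
    refine R.phiInjPos hv hw ?_
    rw [← P.hn_snd v hv, ← P.hn_snd w hw, h]
  · intro w hw
    obtain ⟨v, hv, e⟩ := P.exists_hn hw
    exact ⟨v, hv, e⟩

end Partners

/-- The height function of a rectangular diagram. -/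
def hgt (R : RectDiagram) (vn hn : Torus → Torus) (θ φ : ℝ) : ℤ :=
  ∑ v ∈ R.pos, ⌊θ - toIco v.1⌋ * chi v.2 (vn v).2 φ
    - ∑ v ∈ R.pos, (if toIco v.1 < toIco (hn v).1 then 1 else 0) * ⌊φ - toIco v.2⌋

theorem hgt_eq {R : RectDiagram} {vn hn : Torus → Torus} (P : Partners R vn hn) (θ φ : ℝ) :
    hgt R vn hn θ φ = ∑ v ∈ R.pos, (if toIco (vn v).2 < toIco v.2 then 1 else 0) * ⌊θ - toIco v.1⌋
      - ∑ v ∈ R.pos, ⌊φ - toIco v.2⌋ * chi (hn v).1 v.1 θ := by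
  have e1 := P.sum_vn (fun w => ⌊θ - toIco w.1⌋ * ⌊φ - toIco w.2⌋)
  have e2 := P.sum_hn (fun w => ⌊θ - toIco w.1⌋ * ⌊φ - toIco w.2⌋)
  have e3 : ∑ v ∈ R.pos, ⌊θ - toIco (vn v).1⌋ * ⌊φ - toIco (vn v).2⌋
      = ∑ v ∈ R.pos, ⌊θ - toIco v.1⌋ * ⌊φ - toIco (vn v).2⌋ :=
    Finset.sum_congr rfl (fun v hv => by rw [P.vn_fst v hv])
  have e4 : ∑ v ∈ R.pos, ⌊θ - toIco (hn v).1⌋ * ⌊φ - toIco (hn v).2⌋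
      = ∑ v ∈ R.pos, ⌊φ - toIco v.2⌋ * ⌊θ - toIco (hn v).1⌋ :=
    Finset.sum_congr rfl (fun v hv => by rw [P.hn_snd v hv, mul_comm])
  have e5 : ∑ v ∈ R.pos, ⌊θ - toIco v.1⌋ * ⌊φ - toIco (vn v).2⌋
      = ∑ v ∈ R.pos, ⌊φ - toIco v.2⌋ * ⌊θ - toIco (hn v).1⌋ := by
    rw [← e3, ← e4, e1, e2]
  rw [← sub_eq_zero] at e5
  rw [← sub_eq_zero, hgt]
  rw [← Finset.sum_sub_distrib] at e5
  simp only [← Finset.sum_sub_distrib, chi]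
  rw [← neg_eq_zero, ← Finset.sum_neg_distrib, ← e5]
  exact Finset.sum_congr rfl (fun v hv => by ring)

open Filter Topology in
theorem hgt_local {R : RectDiagram} {vn hn : Torus → Torus} (P : Partners R vn hn) (θ φ : ℝ) :
    ∃ L U : ℤ, (∀ᶠ δ in 𝓝[>] (0:ℝ), hgt R vn hn (θ - δ) (φ + δ) = L) ∧
      (∀ᶠ δ in 𝓝[>] (0:ℝ), hgt R vn hn (θ + δ) (φ - δ) = U) ∧
      U - L = (∑ v ∈ R.pos, (if (θ : 𝕊) = v.1 then 1 else 0) * chi v.2 (vn v).2 φ)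
        + ∑ v ∈ R.pos, (if (φ : 𝕊) = v.2 then 1 else 0) * chi (hn v).1 v.1 θ := by
  refine ⟨∑ v ∈ R.pos, (⌈θ - toIco v.1⌉ - 1) * chi v.2 (vn v).2 φ
    - ∑ v ∈ R.pos, (if toIco v.1 < toIco (hn v).1 then 1 else 0) * ⌊φ - toIco v.2⌋,
    ∑ v ∈ R.pos, (if toIco (vn v).2 < toIco v.2 then 1 else 0) * ⌊θ - toIco v.1⌋
      - ∑ v ∈ R.pos, (⌈φ - toIco v.2⌉ - 1) * chi (hn v).1 v.1 θ, ?_, ?_, ?_⟩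
  · have h1 : ∀ᶠ δ in 𝓝[>] (0:ℝ), ∀ v ∈ R.pos, ⌊θ - δ - toIco v.1⌋ = ⌈θ - toIco v.1⌉ - 1 :=
      (Finset.eventually_all _).2 (fun v _ => ev_floor_sub _ _)
    have h2 : ∀ᶠ δ in 𝓝[>] (0:ℝ), ∀ v ∈ R.pos, chi v.2 (vn v).2 (φ + δ) = chi v.2 (vn v).2 φ :=
      (Finset.eventually_all _).2 (fun v _ => ev_chi _ _ _)
    have h3 : ∀ᶠ δ in 𝓝[>] (0:ℝ), ∀ v ∈ R.pos, ⌊φ + δ - toIco v.2⌋ = ⌊φ - toIco v.2⌋ :=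
      (Finset.eventually_all _).2 (fun v _ => ev_floor_add _ _)
    filter_upwards [h1, h2, h3] with δ h1 h2 h3
    rw [hgt]
    congr 1
    · exact Finset.sum_congr rfl (fun v hv => by rw [h1 v hv, h2 v hv])
    · exact Finset.sum_congr rfl (fun v hv => by rw [h3 v hv])
  · have h1 : ∀ᶠ δ in 𝓝[>] (0:ℝ), ∀ v ∈ R.pos, ⌊φ - δ - toIco v.2⌋ = ⌈φ - toIco v.2⌉ - 1 :=
      (Finset.eventually_all _).2 (fun v _ => ev_floor_sub _ _)
    have h2 : ∀ᶠ δ in 𝓝[>] (0:ℝ), ∀ v ∈ R.pos, chi (hn v).1 v.1 (θ + δ) = chi (hn v).1 v.1 θ :=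
      (Finset.eventually_all _).2 (fun v _ => ev_chi _ _ _)
    have h3 : ∀ᶠ δ in 𝓝[>] (0:ℝ), ∀ v ∈ R.pos, ⌊θ + δ - toIco v.1⌋ = ⌊θ - toIco v.1⌋ :=
      (Finset.eventually_all _).2 (fun v _ => ev_floor_add _ _)
    filter_upwards [h1, h2, h3] with δ h1 h2 h3
    rw [hgt_eq P]
    congr 1
    · exact Finset.sum_congr rfl (fun v hv => by rw [h3 v hv])
    · exact Finset.sum_congr rfl (fun v hv => by rw [h1 v hv, h2 v hv])
  · have e := hgt_eq P θ φ
    rw [hgt] at e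
    simp only [← jump_eq, sub_mul _ (_ : ℤ) (chi _ _ _), Finset.sum_sub_distrib] at e ⊢
    linarith

theorem hgt_height {R : RectDiagram} {vn hn : Torus → Torus} (P : Partners R vn hn) (k l : ℤ)
    (hl : ∀ φ : ℝ, ∑ v ∈ R.pos, chi v.2 (vn v).2 φ = l)
    (hk : ∀ θ : ℝ, ∑ v ∈ R.pos, chi (hn v).1 v.1 θ = k) : Height k l (hgt R vn hn) where
  mono a b φ hab := by
    rw [hgt, hgt]
    have : ∑ v ∈ R.pos, ⌊a - toIco v.1⌋ * chi v.2 (vn v).2 φ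
      ≤ ∑ v ∈ R.pos, ⌊b - toIco v.1⌋ * chi v.2 (vn v).2 φ :=
      Finset.sum_le_sum (fun v _ => mul_le_mul_of_nonneg_right
        (Int.floor_le_floor (by linarith)) (chi_nonneg _ _ _))
    omega
  anti θ a b hab := by
    rw [hgt_eq P, hgt_eq P]
    have : ∑ v ∈ R.pos, ⌊a - toIco v.2⌋ * chi (hn v).1 v.1 θ
      ≤ ∑ v ∈ R.pos, ⌊b - toIco v.2⌋ * chi (hn v).1 v.1 θ :=
      Finset.sum_le_sum (fun v _ => mul_le_mul_of_nonneg_right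
        (Int.floor_le_floor (by linarith)) (chi_nonneg _ _ _))
    omega
  per_θ θ φ := by
    have : ∑ v ∈ R.pos, ⌊θ + 1 - toIco v.1⌋ * chi v.2 (vn v).2 φ
        = ∑ v ∈ R.pos, ⌊θ - toIco v.1⌋ * chi v.2 (vn v).2 φ + l := by
      rw [← hl φ, ← Finset.sum_add_distrib]
      refine Finset.sum_congr rfl (fun v _ => ?_)
      rw [show θ + 1 - toIco v.1 = θ - toIco v.1 + 1 by ring, Int.floor_add_one]; ring
    rw [hgt, hgt, this]; ring
  per_φ θ φ := by
    have : ∑ v ∈ R.pos, ⌊φ + 1 - toIco v.2⌋ * chi (hn v).1 v.1 θ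
        = ∑ v ∈ R.pos, ⌊φ - toIco v.2⌋ * chi (hn v).1 v.1 θ + k := by
      rw [← hk θ, ← Finset.sum_add_distrib]
      refine Finset.sum_congr rfl (fun v _ => ?_)
      rw [show φ + 1 - toIco v.2 = φ - toIco v.2 + 1 by ring, Int.floor_add_one]; ring
    rw [hgt_eq P, hgt_eq P, this]; ring

open Classical in
theorem sum_ind {s : Finset Torus} (A B : Torus → Prop)
    (hA : ∀ v ∈ s, ∀ w ∈ s, A v → A w → v = w) :
    ∑ v ∈ s, (if A v then (1:ℤ) else 0) * (if B v then 1 else 0)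
      = if ∃ v ∈ s, A v ∧ B v then 1 else 0 := by
  split_ifs with h
  · obtain ⟨v, hv, a, b⟩ := h
    rw [Finset.sum_eq_single_of_mem v hv]
    · simp [a, b]
    · intro w hw hne
      have : ¬ A w := fun aw => hne (hA w hw v hv aw a)
      simp [this]
  · refine Finset.sum_eq_zero (fun v hv => ?_)
    by_cases a : A v
    · have : ¬ B v := fun b => h ⟨v, hv, a, b⟩
      simp [this]
    · simp [a]

/-- On a half-open vertical edge. -/
def VP (R : RectDiagram) (vn : Torus → Torus) (p : Torus) : Prop :=
  ∃ v ∈ R.pos, p.1 = v.1 ∧ toIco (p.2 - v.2) < toIco ((vn v).2 - v.2)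

/-- On a half-open horizontal edge. -/
def HP (R : RectDiagram) (hn : Torus → Torus) (p : Torus) : Prop :=
  ∃ v ∈ R.pos, p.2 = v.2 ∧ toIco (p.1 - (hn v).1) < toIco (v.1 - (hn v).1)

open Classical in
theorem sumV {R : RectDiagram} {vn : Torus → Torus} (θ φ : ℝ) :
    (∑ v ∈ R.pos, (if (θ : 𝕊) = v.1 then 1 else 0) * chi v.2 (vn v).2 φ)
      = if VP R vn ((θ : 𝕊), (φ : 𝕊)) then 1 else 0 := by
  simp only [chi_eq]
  convert sum_ind (s := R.pos) (fun v => (θ : 𝕊) = v.1)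
    (fun v => toIco ((φ : 𝕊) - v.2) < toIco ((vn v).2 - v.2))
    (fun v hv w hw a b => R.thetaInjPos hv hw (a.symm.trans b))
  exact Iff.rfl

open Classical in
theorem sumH {R : RectDiagram} {hn : Torus → Torus} (θ φ : ℝ) :
    (∑ v ∈ R.pos, (if (φ : 𝕊) = v.2 then 1 else 0) * chi (hn v).1 v.1 θ)
      = if HP R hn ((θ : 𝕊), (φ : 𝕊)) then 1 else 0 := by
  simp only [chi_eq]
  convert sum_ind (s := R.pos) (fun v => (φ : 𝕊) = v.2)
    (fun v => toIco ((θ : 𝕊) - (hn v).1) < toIco (v.1 - (hn v).1))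
    (fun v hv w hw a b => R.phiInjPos hv hw (a.symm.trans b))
  exact Iff.rfl

theorem gamma_iff {R : RectDiagram} {vn hn : Torus → Torus} (P : Partners R vn hn) (p : Torus) :
    p ∈ Gamma R ↔ VP R vn p ∨ HP R hn p := by
  obtain ⟨θ, φ⟩ := p
  constructor
  · rintro (⟨θ₀, φ₁, φ₂, h1, h2, h3, h4⟩ | ⟨θ₁, θ₂, φ₀, h1, h2, h3, h4⟩)
    · dsimp only at h3 h4
      subst h3
      have e := P.vn_eq h1 h2 rfl
      rcases lt_or_eq_of_le (show toIco (φ - φ₁) ≤ toIco (φ₂ - φ₁) from h4) with h | h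
      · exact Or.inl ⟨_, h1, rfl, by rw [e]; exact h⟩
      · have : φ = φ₂ := sub_left_injective (toIco_inj h)
        subst this
        right
        obtain ⟨w, hw, ew⟩ := P.exists_hn h2
        have e2 := P.hn_snd w hw
        refine ⟨w, hw, ?_, ?_⟩
        · rw [← e2, ew]
        · rw [ew]
          simp only [sub_self, toIco_zero]
          refine toIco_pos (fun hh => Partners.ne hw h2 (Prod.ext hh ?_))
          rw [← e2, ew]
    · dsimp only at h3 h4
      subst h3
      have e := P.hn_eq h2 h1 rfl
      rcases lt_or_eq_of_le (show toIco (θ - θ₁) ≤ toIco (θ₂ - θ₁) from h4) with h | h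
      · exact Or.inr ⟨_, h2, rfl, by rw [e]; exact h⟩
      · have : θ = θ₂ := sub_left_injective (toIco_inj h)
        subst this
        left
        refine ⟨_, h2, rfl, ?_⟩
        simp only [sub_self, toIco_zero]
        refine toIco_pos (fun hh => Partners.ne h2 (P.vn_mem _ h2) (Prod.ext ?_ hh.symm))
        rw [P.vn_fst _ h2]
  · rintro (⟨v, hv, h1, h2⟩ | ⟨v, hv, h1, h2⟩)
    · left
      refine ⟨v.1, v.2, (vn v).2, hv, ?_, h1, h2.le⟩
      rw [← P.vn_fst v hv]; exact P.vn_mem v hv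
    · right
      refine ⟨(hn v).1, v.1, v.2, ?_, hv, h1, h2.le⟩
      rw [← P.hn_snd v hv]; exact P.hn_mem v hv

theorem double_iff {R : RectDiagram} {vn hn : Torus → Torus} (P : Partners R vn hn) (p : Torus) :
    p ∈ DoublePts R ↔ VP R vn p ∧ HP R hn p := by
  obtain ⟨θ, φ⟩ := p
  constructor
  · rintro ⟨⟨θ₀, φ₁, φ₂, h1, h2, h3, h4⟩, ⟨θ₁, θ₂, φ₀, h1', h2', h3', h4'⟩⟩
    dsimp only at h3 h4 h3' h4'
    subst h3; subst h3'
    refine ⟨⟨_, h1, rfl, ?_⟩, ⟨_, h2', rfl, ?_⟩⟩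
    · rw [P.vn_eq h1 h2 rfl]; exact h4.2
    · rw [P.hn_eq h2' h1' rfl]; exact h4'.2
  · rintro ⟨⟨v, hv, h1, h2⟩, ⟨w, hw, h1', h2'⟩⟩
    dsimp only at h1 h2 h1' h2'
    subst h1; subst h1'
    refine ⟨⟨v.1, v.2, (vn v).2, hv, ?_, rfl, ?_, h2⟩, ⟨(hn w).1, w.1, w.2, ?_, hw, rfl, ?_, h2'⟩⟩
    · rw [← P.vn_fst v hv]; exact P.vn_mem v hv
    · refine toIco_pos (fun hh => ?_)
      dsimp only at hh
      have := R.phiInjPos hw hv hh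
      subst this
      exact lt_irrefl _ h2'
    · rw [← P.hn_snd w hw]; exact P.hn_mem w hw
    · refine toIco_pos (fun hh => ?_)
      dsimp only at hh
      have := P.vn_eq hv (P.hn_mem w hw) hh
      rw [this, P.hn_snd w hw] at h2
      exact lt_irrefl _ h2

theorem double_finite (R : RectDiagram) : (DoublePts R).Finite := by
  refine Set.Finite.subset ((R.pθ ×ˢ R.pφ).finite_toSet) ?_
  rintro ⟨θ, φ⟩ ⟨⟨θ₀, φ₁, φ₂, h1, h2, h3, h4⟩, ⟨θ₁, θ₂, φ₀, h1', h2', h3', h4'⟩⟩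
  dsimp only at h3 h3'
  subst h3; subst h3'
  simp only [Finset.coe_product, Set.mem_prod, Finset.mem_coe, RectDiagram.pθ, RectDiagram.pφ,
    Finset.mem_image, RectDiagram.verts, Finset.mem_union]
  exact ⟨⟨_, Or.inl h1, rfl⟩, ⟨_, Or.inr h1', rfl⟩⟩

open Filter Topology in
theorem ev_avoid (F : Finset 𝕊) (y : ℝ) : ∀ᶠ δ in 𝓝[>] (0:ℝ), ((y + δ : ℝ) : 𝕊) ∉ F := by
  have : ∀ᶠ δ in 𝓝[>] (0:ℝ), ∀ a ∈ F, ((y + δ : ℝ) : 𝕊) ≠ a := by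
    refine (Finset.eventually_all _).2 (fun a _ => ?_)
    have h1 := Int.lt_floor_add_one (y - toIco a)
    have h2 := Int.floor_le (y - toIco a)
    filter_upwards [Ioo_mem_nhdsGT (show (0:ℝ) < ⌊y - toIco a⌋ + 1 - (y - toIco a) by linarith)]
      with δ hδ he
    rw [← coe_toIco a, circ_eq_iff] at he
    obtain ⟨m, hm⟩ := he
    have a1 : (⌊y - toIco a⌋ : ℝ) < m := by linarith [hδ.1]
    have a2 : (m : ℝ) < ⌊y - toIco a⌋ + 1 := by linarith [hδ.2]
    have a1' : ⌊y - toIco a⌋ < m := by exact_mod_cast a1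
    have a2' : m < ⌊y - toIco a⌋ + 1 := by exact_mod_cast a2
    omega
  filter_upwards [this] with δ h hm
  exact h _ hm rfl

open Filter Topology in
theorem sum_chi_vert {R : RectDiagram} {vn hn : Torus → Torus} (P : Partners R vn hn) {k l : ℕ}
    (hR : IsHomClass R k l) (φ : ℝ) : ∑ v ∈ R.pos, chi v.2 (vn v).2 φ = l := by
  have h2 : ∀ᶠ δ in 𝓝[>] (0:ℝ), ∀ v ∈ R.pos, chi v.2 (vn v).2 (φ + δ) = chi v.2 (vn v).2 φ :=
    (Finset.eventually_all _).2 (fun v _ => ev_chi _ _ _)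
  obtain ⟨δ, h1, h2⟩ := ((ev_avoid R.pφ φ).and h2).exists
  rw [← Finset.sum_congr rfl h2, ← hR.2 _ h1, lonCount]
  set y := ((φ + δ : ℝ) : 𝕊) with hy
  have : Gamma R ∩ {p | p.2 = y} = ((R.pos.filter
      (fun v => toIco (y - v.2) < toIco ((vn v).2 - v.2))).image (fun v => (v.1, y)) : Finset Torus) := by
    ext ⟨a, b⟩
    simp only [Finset.coe_image, Set.mem_image, Finset.coe_filter, Set.mem_inter_iff, gamma_iff P]
    constructor
    · rintro ⟨⟨v, hv, e1, e2⟩ | ⟨v, hv, e1, e2⟩, hb⟩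
      · change b = y at hb
        subst hb
        exact ⟨v, ⟨hv, e2⟩, Prod.ext e1.symm rfl⟩
      · change b = y at hb
        subst hb
        exact absurd (Finset.mem_image.2 ⟨v, Finset.mem_union_left _ hv, e1.symm⟩) h1
    · rintro ⟨v, ⟨hv, e2⟩, e⟩
      rw [Prod.mk.injEq] at e
      obtain ⟨e1, rfl⟩ := e
      exact ⟨Or.inl ⟨v, hv, e1.symm, e2⟩, rfl⟩
  rw [this, Set.ncard_coe_finset, Finset.card_image_of_injOn, Finset.card_filter]
  · push_cast
    exact Finset.sum_congr rfl (fun v _ => chi_eq _ _ _)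
  · intro v hv w hw e
    exact R.thetaInjPos (Finset.mem_filter.1 hv).1 (Finset.mem_filter.1 hw).1 (Prod.ext_iff.1 e).1

open Filter Topology in
theorem sum_chi_horiz {R : RectDiagram} {vn hn : Torus → Torus} (P : Partners R vn hn) {k l : ℕ}
    (hR : IsHomClass R k l) (θ : ℝ) : ∑ v ∈ R.pos, chi (hn v).1 v.1 θ = k := by
  have h2 : ∀ᶠ δ in 𝓝[>] (0:ℝ), ∀ v ∈ R.pos, chi (hn v).1 v.1 (θ + δ) = chi (hn v).1 v.1 θ :=
    (Finset.eventually_all _).2 (fun v _ => ev_chi _ _ _)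
  obtain ⟨δ, h1, h2⟩ := ((ev_avoid R.pθ θ).and h2).exists
  rw [← Finset.sum_congr rfl h2, ← hR.1 _ h1, merCount]
  set y := ((θ + δ : ℝ) : 𝕊) with hy
  have : Gamma R ∩ {p | p.1 = y} = ((R.pos.filter
      (fun v => toIco (y - (hn v).1) < toIco (v.1 - (hn v).1))).image (fun v => (y, v.2)) : Finset Torus) := by
    ext ⟨a, b⟩
    simp only [Finset.coe_image, Set.mem_image, Finset.coe_filter, Set.mem_inter_iff, gamma_iff P]
    constructor
    · rintro ⟨⟨v, hv, e1, e2⟩ | ⟨v, hv, e1, e2⟩, hb⟩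
      · change a = y at hb
        subst hb
        exact absurd (Finset.mem_image.2 ⟨v, Finset.mem_union_left _ hv, e1.symm⟩) h1
      · change a = y at hb
        subst hb
        exact ⟨v, ⟨hv, e2⟩, Prod.ext rfl e1.symm⟩
    · rintro ⟨v, ⟨hv, e2⟩, e⟩
      rw [Prod.mk.injEq] at e
      obtain ⟨rfl, e1⟩ := e
      exact ⟨Or.inr ⟨v, hv, e1.symm, e2⟩, rfl⟩
  rw [this, Set.ncard_coe_finset, Finset.card_image_of_injOn, Finset.card_filter]
  · push_cast
    exact Finset.sum_congr rfl (fun v _ => chi_eq _ _ _)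
  · intro v hv w hw e
    exact R.phiInjPos (Finset.mem_filter.1 hv).1 (Finset.mem_filter.1 hw).1 (Prod.ext_iff.1 e).2

/-- The strand system `x` describes the diagram `R`. -/
structure Describes (R : RectDiagram) (n k : ℤ) (x : ℤ → ℝ → ℝ) : Prop where
  str : Strands n k x
  gam : ∀ θ φ : ℝ, ((θ : 𝕊), (φ : 𝕊)) ∈ Gamma R ↔ ∃ i, x i (θ + φ) = θ
  dbl : ∀ θ φ : ℝ, ((θ : 𝕊), (φ : 𝕊)) ∈ DoublePts R ↔
    ∃ i, x i (θ + φ) = θ ∧ x (i + 1) (θ + φ) = θ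

theorem exists_describes (R : RectDiagram) {k l : ℕ} (hk : 1 ≤ k)
    (hR : IsHomClass R k l) : ∃ x, Describes R (k + l) k x := by
  obtain ⟨vn, hn, P⟩ := exists_partners R
  have H := hgt_height P k l (sum_chi_vert P hR) (sum_chi_horiz P hR)
  have hpos : (0:ℤ) < k + l := by omega
  refine ⟨xs (hgt R vn hn), H.strands hpos, fun θ φ => ?_, fun θ φ => ?_⟩
  · obtain ⟨L, U, h1, h2, h3⟩ := hgt_local P θ φ
    simp only [H.xs_iff hpos h1 h2]
    rw [sumV, sumH] at h3
    rw [gamma_iff P]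
    constructor
    · rintro (h | h)
      · refine ⟨U, ?_, le_rfl⟩
        rw [if_pos h] at h3
        split_ifs at h3 <;> omega
      · refine ⟨U, ?_, le_rfl⟩
        rw [if_pos h] at h3
        split_ifs at h3 <;> omega
    · rintro ⟨i, hi⟩
      by_contra hcon
      rw [not_or] at hcon
      rw [if_neg hcon.1, if_neg hcon.2] at h3
      omega
  · obtain ⟨L, U, h1, h2, h3⟩ := hgt_local P θ φ
    simp only [H.xs_iff hpos h1 h2]
    rw [sumV, sumH] at h3
    rw [double_iff P]
    constructor
    · rintro ⟨hv, hh⟩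
      rw [if_pos hv, if_pos hh] at h3
      exact ⟨L + 1, by omega, by omega⟩
    · rintro ⟨i, hi, hi'⟩
      by_contra hcon
      rw [not_and_or] at hcon
      rcases hcon with hcon | hcon
      · rw [if_neg hcon] at h3
        split_ifs at h3 <;> omega
      · rw [if_neg hcon] at h3
        split_ifs at h3 <;> omega

theorem Describes.shift {R : RectDiagram} {n k : ℤ} {x : ℤ → ℝ → ℝ} (D : Describes R n k x)
    (j : ℤ) : Describes R n k (fun i => x (i + j)) where
  str :=
    { mono_s := fun i => D.str.mono_s _
      lip := fun i => D.str.lip _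
      le_succ := fun i s => by
        rw [show i + 1 + j = i + j + 1 by ring]; exact D.str.le_succ _ _
      per_n := fun i s => by
        rw [show i + n + j = i + j + n by ring]; exact D.str.per_n _ _
      per_k := fun i s => by
        rw [show i - k + j = i + j - k by ring]; exact D.str.per_k _ _ }
  gam θ φ := by
    rw [D.gam]
    constructor
    · rintro ⟨i, h⟩; exact ⟨i - j, by rw [sub_add_cancel]; exact h⟩
    · rintro ⟨i, h⟩; exact ⟨_, h⟩
  dbl θ φ := by
    rw [D.dbl]
    constructor
    · rintro ⟨i, h, h'⟩
      exact ⟨i - j, by rw [sub_add_cancel]; exact h,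
        by rw [show i - j + 1 + j = i + 1 by ring]; exact h'⟩
    · rintro ⟨i, h, hb⟩
      exact ⟨_, h, by rw [show i + 1 + j = i + j + 1 by ring] at hb; exact hb⟩

/-- Normalized description. -/
theorem exists_describes_norm (R : RectDiagram) {k l : ℕ} (hk : 1 ≤ k)
    (hR : IsHomClass R k l) : ∃ x, Describes R (k + l) k x ∧ 0 ≤ x 0 0 ∧ x 0 0 < 1 := by
  obtain ⟨x, D⟩ := exists_describes R hk hR
  refine ⟨_, D.shift ((k + l : ℤ) * (-⌊x 0 0⌋)), ?_⟩
  rw [D.str.per_nb]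
  have := Int.floor_le (x 0 0)
  have := Int.lt_floor_add_one (x 0 0)
  push_cast
  constructor <;> linarith

/-- Only finitely many indices occur in the fundamental domain. -/
theorem index_bound {n k : ℤ} (hn : 0 < n) {x : ℤ → ℝ → ℝ} (h : Strands n k x) (h0 : 0 ≤ x 0 0)
    (h1 : x 0 0 < 1) (θ φ : ℝ) (hθ : θ ∈ Ico (0:ℝ) 1) (hφ : φ ∈ Ico (0:ℝ) 1) (i : ℤ)
    (hi : x i (θ + φ) = θ) : i ∈ Icc (-4 * n) (4 * n) := by
  obtain ⟨a0, a1⟩ := hθ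
  obtain ⟨b0, b1⟩ := hφ
  have m1 := h.mono_s i 0 (θ + φ) (by linarith)
  have m2 := h.lip i 0 (θ + φ) (by linarith)
  have e1 := h.per_nb (-4) 0 0
  have e2 := h.per_nb 4 0 0
  push_cast at e1 e2
  rw [zero_add] at e1 e2
  constructor
  · by_contra hlt
    have : x i 0 ≤ x (n * -4) 0 := h.mono 0 (by linarith)
    linarith
  · by_contra hlt
    have : x (n * 4) 0 ≤ x i 0 := h.mono 0 (by linarith)
    linarith

/-- The finite combinatorial data. -/
def sdata (x : ℤ → ℝ → ℝ) (n : ℤ) (G : Set 𝕊) : Set (ℤ × Torus) :=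
  {q | q.1 ∈ Icc (-4 * n) (4 * n) ∧ q.2.1 ∈ G ∧ q.2.2 ∈ G ∧
    x q.1 (toIco q.2.1 + toIco q.2.2) = toIco q.2.1}

theorem touch_transfer {n k : ℤ} (hn : 0 < n) {R : RectDiagram} {x x' : ℤ → ℝ → ℝ}
    (D : Describes R n k x) (h' : Strands n k x') (h0 : 0 ≤ x 0 0) (h1 : x 0 0 < 1) (G : Set 𝕊)
    (hG : DoublePts R ⊆ G ×ˢ G) (hd : sdata x n G = sdata x' n G) (i : ℤ) (s : ℝ)
    (he : x i s = x (i + 1) s) : x' i s = x i s ∧ x' (i + 1) s = x i s := by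
  set θ := x i s with hθ
  have hp : ((θ : 𝕊), ((s - θ : ℝ) : 𝕊)) ∈ DoublePts R :=
    (D.dbl θ (s - θ)).2 ⟨i, by rw [add_sub_cancel], by rw [add_sub_cancel]; exact he.symm⟩
  have hpG := hG hp
  -- translate to the fundamental domain
  set b : ℤ := -⌊θ⌋ with hb
  set c : ℤ := -⌊s - θ⌋ with hc
  have t1 : toIco (θ : 𝕊) = θ + b := by
    rw [toIco_coe, Int.fract, hb]; push_cast; ring
  have t2 : toIco ((s - θ : ℝ) : 𝕊) = s - θ + c := by
    rw [toIco_coe, Int.fract, hc]; push_cast; ring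
  have key : ∀ j, x j s = θ → x' j s = θ := by
    intro j hj
    have e := D.str.per (b + c) b j s
    have e' := h'.per (b + c) b j s
    have es : s + ((b + c : ℤ) : ℝ) = toIco (θ : 𝕊) + toIco ((s - θ : ℝ) : 𝕊) := by
      rw [t1, t2]; push_cast; ring
    rw [es] at e e'
    rw [hj, ← t1] at e
    have hmem : (j - k * (b + c) + n * b, ((θ : 𝕊), ((s - θ : ℝ) : 𝕊))) ∈ sdata x n G :=
      ⟨index_bound hn D.str h0 h1 _ _ ⟨toIco_nonneg _, toIco_lt_one _⟩
        ⟨toIco_nonneg _, toIco_lt_one _⟩ _ e, hpG.1, hpG.2, e⟩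
    rw [hd] at hmem
    have e2 := hmem.2.2.2
    dsimp only at e2
    rw [e2, t1] at e'
    linarith
  exact ⟨key i rfl, key (i + 1) he.symm⟩

theorem gamma_strands {n k : ℤ} {R : RectDiagram} {x : ℤ → ℝ → ℝ} (D : Describes R n k x) :
    Gamma R = {p | ∃ i s, spt x i s = p} := by
  ext p
  constructor
  · intro hp
    obtain ⟨p1, p2⟩ := p
    obtain ⟨θ, rfl⟩ := QuotientAddGroup.mk_surjective p1
    obtain ⟨φ, rfl⟩ := QuotientAddGroup.mk_surjective p2
    obtain ⟨i, hi⟩ := (D.gam θ φ).1 hp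
    refine ⟨i, θ + φ, ?_⟩
    rw [spt, hi, add_sub_cancel_left]
  · rintro ⟨i, s, rfl⟩
    exact (D.gam (x i s) (s - x i s)).2 ⟨i, by rw [add_sub_cancel]⟩

theorem isotopic_of_sdata {n k : ℤ} (hn : 0 < n) {R R' : RectDiagram} {x x' : ℤ → ℝ → ℝ}
    (D : Describes R n k x) (D' : Describes R' n k x') (h0 : 0 ≤ x 0 0) (h1 : x 0 0 < 1)
    (h0' : 0 ≤ x' 0 0) (h1' : x' 0 0 < 1) (G : Set 𝕊)
    (hG : DoublePts R ⊆ G ×ˢ G) (hG' : DoublePts R' ⊆ G ×ˢ G)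
    (hd : sdata x n G = sdata x' n G) :
    IsotopicRelFixed (Gamma R) (Gamma R') (DoublePts R) := by
  refine isotopic_of_strands hn D.str D'.str (fun i s => ⟨fun he => ?_, fun he => ?_⟩) _ _ _
    (gamma_strands D) (gamma_strands D') ?_
  · have := touch_transfer hn D D'.str h0 h1 G hG hd i s he
    rw [this.1, this.2]
  · have := touch_transfer hn D' D.str h0' h1' G hG' hd.symm i s he
    rw [this.1, this.2]
  · rintro ⟨p1, p2⟩ hp
    obtain ⟨θ, rfl⟩ := QuotientAddGroup.mk_surjective p1
    obtain ⟨φ, rfl⟩ := QuotientAddGroup.mk_surjective p2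
    obtain ⟨i, hi, hi'⟩ := (D.dbl θ φ).1 hp
    refine ⟨i, θ + φ, ?_, ?_⟩
    · rw [spt, hi, add_sub_cancel_left]
    · exact (touch_transfer hn D D'.str h0 h1 G hG hd i _ (hi.trans hi'.symm)).1.symm

/-! ### Orientation preserving circle homeomorphisms -/

theorem orient_open {f : 𝕊 ≃ₜ 𝕊} (hf : OrientPres f) (a b c : 𝕊) :
    f b ∈ openArc (f a) (f c) ↔ b ∈ openArc a c := by
  refine ⟨fun h => ?_, hf a b c⟩
  have hba : b ≠ a := by
    rintro rfl
    have := h.1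
    rw [sub_self, toIco_zero] at this
    exact lt_irrefl _ this
  refine ⟨toIco_pos hba, ?_⟩
  by_contra hle
  rcases lt_or_eq_of_le (not_lt.1 hle) with hlt | he
  · by_cases hca : c = a
    · subst hca
      have h1 := h.1
      have h2 := h.2
      rw [sub_self (f c), toIco_zero] at h2
      linarith
    · have := (hf a c b ⟨toIco_pos hca, hlt⟩).2
      have h2 := h.2
      linarith
  · have : c = b := sub_left_injective (toIco_inj he)
    subst this
    exact lt_irrefl _ h.2

theorem mem_closedArc_iff (a b x : 𝕊) :
    x ∈ closedArc a b ↔ x = a ∨ x = b ∨ x ∈ openArc a b := by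
  constructor
  · intro h
    by_cases hx : x = a
    · exact Or.inl hx
    · rcases lt_or_eq_of_le (show toIco (x - a) ≤ toIco (b - a) from h) with hlt | he
      · exact Or.inr (Or.inr ⟨toIco_pos hx, hlt⟩)
      · exact Or.inr (Or.inl (sub_left_injective (toIco_inj he)))
  · rintro (rfl | rfl | h)
    · show toIco (x - x) ≤ _
      rw [sub_self, toIco_zero]; exact toIco_nonneg _
    · show toIco _ ≤ toIco _
      exact le_refl _
    · exact h.2.le

theorem orient_closed {f : 𝕊 ≃ₜ 𝕊} (hf : OrientPres f) (a b x : 𝕊) :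
    f x ∈ closedArc (f a) (f b) ↔ x ∈ closedArc a b := by
  rw [mem_closedArc_iff, mem_closedArc_iff, orient_open hf, f.injective.eq_iff, f.injective.eq_iff]

theorem orient_symm {f : 𝕊 ≃ₜ 𝕊} (hf : OrientPres f) : OrientPres f.symm := by
  intro a b c h
  rw [← orient_open hf]
  simpa using h

/-- The product homeomorphism. -/
def prodH (f g : 𝕊 ≃ₜ 𝕊) : Torus ≃ₜ Torus := f.prodCongr g

theorem prodH_apply (f g : 𝕊 ≃ₜ 𝕊) (p : Torus) : prodH f g p = (f p.1, g p.2) := rfl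

theorem image_map_fst (f g : 𝕊 ≃ₜ 𝕊) (s : Finset Torus) :
    (s.map (prodH f g).toEquiv.toEmbedding).image Prod.fst = (s.image Prod.fst).image f := by
  rw [Finset.map_eq_image, Finset.image_image, Finset.image_image]
  rfl

theorem image_map_snd (f g : 𝕊 ≃ₜ 𝕊) (s : Finset Torus) :
    (s.map (prodH f g).toEquiv.toEmbedding).image Prod.snd = (s.image Prod.snd).image g := by
  rw [Finset.map_eq_image, Finset.image_image, Finset.image_image]
  rfl

theorem injOn_map_fst (f g : 𝕊 ≃ₜ 𝕊) (s : Finset Torus) (h : Set.InjOn Prod.fst (s : Set Torus)) :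
    Set.InjOn Prod.fst (s.map (prodH f g).toEquiv.toEmbedding : Set Torus) := by
  intro v hv w hw e
  obtain ⟨v', hv', rfl⟩ := Finset.mem_map.1 hv
  obtain ⟨w', hw', rfl⟩ := Finset.mem_map.1 hw
  rw [h hv' hw' (f.injective e)]

theorem injOn_map_snd (f g : 𝕊 ≃ₜ 𝕊) (s : Finset Torus) (h : Set.InjOn Prod.snd (s : Set Torus)) :
    Set.InjOn Prod.snd (s.map (prodH f g).toEquiv.toEmbedding : Set Torus) := by
  intro v hv w hw e
  obtain ⟨v', hv', rfl⟩ := Finset.mem_map.1 hv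
  obtain ⟨w', hw', rfl⟩ := Finset.mem_map.1 hw
  rw [h hv' hw' (g.injective e)]

/-- The image of a diagram under a product homeomorphism. -/
def mapR (f g : 𝕊 ≃ₜ 𝕊) (R : RectDiagram) : RectDiagram where
  pos := R.pos.map (prodH f g).toEquiv.toEmbedding
  neg := R.neg.map (prodH f g).toEquiv.toEmbedding
  disj := (Finset.disjoint_map _).2 R.disj
  nonempty := by
    rw [← Finset.map_union]; exact R.nonempty.map
  thetaEq := by rw [image_map_fst, image_map_fst, R.thetaEq]
  phiEq := by rw [image_map_snd, image_map_snd, R.phiEq]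
  thetaInjPos := injOn_map_fst f g _ R.thetaInjPos
  thetaInjNeg := injOn_map_fst f g _ R.thetaInjNeg
  phiInjPos := injOn_map_snd f g _ R.phiInjPos
  phiInjNeg := injOn_map_snd f g _ R.phiInjNeg

theorem mapR_pos (f g : 𝕊 ≃ₜ 𝕊) (R : RectDiagram) (a b : 𝕊) :
    (f a, g b) ∈ (mapR f g R).pos ↔ (a, b) ∈ R.pos := by
  show prodH f g (a, b) ∈ R.pos.map _ ↔ _
  exact Finset.mem_map' _

theorem mapR_neg (f g : 𝕊 ≃ₜ 𝕊) (R : RectDiagram) (a b : 𝕊) :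
    (f a, g b) ∈ (mapR f g R).neg ↔ (a, b) ∈ R.neg := by
  show prodH f g (a, b) ∈ R.neg.map _ ↔ _
  exact Finset.mem_map' _

theorem mapR_gamma {f g : 𝕊 ≃ₜ 𝕊} (hf : OrientPres f) (hg : OrientPres g) (R : RectDiagram)
    (p : Torus) : prodH f g p ∈ Gamma (mapR f g R) ↔ p ∈ Gamma R := by
  obtain ⟨θ, φ⟩ := p
  rw [prodH_apply]
  simp only [Gamma, Set.mem_union, Set.mem_ofPred_eq]
  refine or_congr ?_ ?_
  · rw [f.surjective.exists]
    refine exists_congr fun a => ?_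
    rw [g.surjective.exists]
    refine exists_congr fun b => ?_
    rw [g.surjective.exists]
    refine exists_congr fun c => ?_
    rw [mapR_pos, mapR_neg, orient_closed hg, f.injective.eq_iff]
  · rw [f.surjective.exists]
    refine exists_congr fun a => ?_
    rw [f.surjective.exists]
    refine exists_congr fun b => ?_
    rw [g.surjective.exists]
    refine exists_congr fun c => ?_
    rw [mapR_pos, mapR_neg, orient_closed hf, g.injective.eq_iff]

theorem mapR_double {f g : 𝕊 ≃ₜ 𝕊} (hf : OrientPres f) (hg : OrientPres g) (R : RectDiagram)
    (p : Torus) : prodH f g p ∈ DoublePts (mapR f g R) ↔ p ∈ DoublePts R := by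
  obtain ⟨θ, φ⟩ := p
  rw [prodH_apply]
  simp only [DoublePts, OnVertInt, OnHorizInt, Set.mem_ofPred_eq]
  refine and_congr ?_ ?_
  · rw [f.surjective.exists]
    refine exists_congr fun a => ?_
    rw [g.surjective.exists]
    refine exists_congr fun b => ?_
    rw [g.surjective.exists]
    refine exists_congr fun c => ?_
    rw [mapR_pos, mapR_neg, orient_open hg, f.injective.eq_iff]
  · rw [f.surjective.exists]
    refine exists_congr fun a => ?_
    rw [f.surjective.exists]
    refine exists_congr fun b => ?_
    rw [g.surjective.exists]
    refine exists_congr fun c => ?_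
    rw [mapR_pos, mapR_neg, orient_open hf, g.injective.eq_iff]

theorem mapR_homClass {f g : 𝕊 ≃ₜ 𝕊} (hf : OrientPres f) (hg : OrientPres g) {R : RectDiagram}
    {k l : ℕ} (hR : IsHomClass R k l) : IsHomClass (mapR f g R) k l := by
  constructor
  · intro y hy
    obtain ⟨θ, rfl⟩ := f.surjective y
    have hθ : θ ∉ R.pθ := fun h => hy (by
      rw [RectDiagram.pθ, RectDiagram.verts, mapR, ← Finset.map_union, image_map_fst]
      exact Finset.mem_image_of_mem _ h)
    have key : Gamma (mapR f g R) ∩ {p | p.1 = f θ} =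
        prodH f g '' (Gamma R ∩ {p | p.1 = θ}) := by
      ext p
      obtain ⟨p, rfl⟩ := (prodH f g).surjective p
      rw [(prodH f g).injective.mem_set_image]
      exact and_congr (mapR_gamma hf hg R p) f.injective.eq_iff
    rw [← hR.1 θ hθ]
    exact (congrArg Set.ncard key).trans (Set.ncard_image_of_injective _ (prodH f g).injective)
  · intro y hy
    obtain ⟨φ, rfl⟩ := g.surjective y
    have hφ : φ ∉ R.pφ := fun h => hy (by
      rw [RectDiagram.pφ, RectDiagram.verts, mapR, ← Finset.map_union, image_map_snd]
      exact Finset.mem_image_of_mem _ h)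
    have key : Gamma (mapR f g R) ∩ {p | p.2 = g φ} =
        prodH f g '' (Gamma R ∩ {p | p.2 = φ}) := by
      ext p
      obtain ⟨p, rfl⟩ := (prodH f g).surjective p
      rw [(prodH f g).injective.mem_set_image]
      exact and_congr (mapR_gamma hf hg R p) g.injective.eq_iff
    rw [← hR.2 φ hφ]
    exact (congrArg Set.ncard key).trans (Set.ncard_image_of_injective _ (prodH f g).injective)

/-- Isotopy of the image diagrams can be pulled back. -/
theorem sameHom_of_map {f g : 𝕊 ≃ₜ 𝕊} (hf : OrientPres f) (hg : OrientPres g)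
    {R R' : RectDiagram}
    (h : IsotopicRelFixed (Gamma (mapR f g R)) (Gamma R') (DoublePts (mapR f g R))) :
    SameHomType R R' := by
  refine ⟨mapR f.symm g.symm R', ⟨f.symm, g.symm, orient_symm hf, orient_symm hg, ?_, ?_⟩, ?_⟩
  · exact (Finset.coe_map (prodH f.symm g.symm).toEquiv.toEmbedding R'.pos).symm
  · exact (Finset.coe_map (prodH f.symm g.symm).toEquiv.toEmbedding R'.neg).symm
  · obtain ⟨H, ⟨hc, h0⟩, hX, hA⟩ := h
    have hinv : ∀ p, prodH f.symm g.symm p = (prodH f g).symm p := fun p => rfl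
    refine ⟨fun t => ((prodH f g).trans (H t)).trans (prodH f g).symm, ⟨?_, ?_⟩, ?_, ?_⟩
    · have c1 : Continuous (fun q : ℝ × Torus => ((q.1, prodH f g q.2) : ℝ × Torus)) := by
        have := (prodH f g).continuous
        fun_prop
      exact (prodH f g).symm.continuous.comp (hc.comp c1)
    · show ((prodH f g).trans (H 0)).trans (prodH f g).symm = _
      rw [h0]; ext1 p; simp
    · intro t x hx
      have := hX t (prodH f g x) ((mapR_double hf hg R x).2 hx)
      simp [this]
    · ext p
      obtain ⟨p, rfl⟩ := (prodH f g).symm.surjective p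
      rw [← hinv p, mapR_gamma (orient_symm hf) (orient_symm hg), ← hA, hinv]
      constructor
      · rintro ⟨y, hy, e⟩
        refine ⟨prodH f g y, (mapR_gamma hf hg R y).2 hy, ?_⟩
        exact (prodH f g).symm.injective e
      · rintro ⟨y, hy, rfl⟩
        obtain ⟨y, rfl⟩ := (prodH f g).surjective y
        exact ⟨y, (mapR_gamma hf hg R y).1 hy, rfl⟩

/-! ### Moving finite sets of the circle into a grid -/

theorem per_int (F : ℝ → ℝ) (hF : ∀ x, F (x + 1) = F x + 1) (x : ℝ) (m : ℤ) :
    F (x + m) = F x + m := by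
  induction m using Int.induction_on with
  | zero => simp
  | succ m ih =>
    have := hF (x + ((m : ℤ) : ℝ))
    rw [ih] at this
    push_cast at this ⊢
    rw [← add_assoc, this]; ring
  | pred m ih =>
    have := hF (x + ((-(m : ℤ) - 1 : ℤ) : ℝ))
    rw [show x + ((-(m : ℤ) - 1 : ℤ) : ℝ) + 1 = x + ((-(m : ℤ) : ℤ) : ℝ) by push_cast; ring,
      ih] at this
    push_cast at this ⊢
    linarith

/-- The circle map induced by a periodic real map. -/
def cmap (F : ℝ → ℝ) (p : 𝕊) : 𝕊 := (F (toIco p) : 𝕊)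

theorem cmap_coe (F : ℝ → ℝ) (hF : ∀ x, F (x + 1) = F x + 1) (y : ℝ) :
    cmap F (y : 𝕊) = (F y : 𝕊) := by
  rw [cmap, toIco_coe, circ_eq_iff]
  refine ⟨-⌊y⌋, ?_⟩
  rw [← per_int F hF]
  congr 1
  rw [Int.fract]; push_cast; ring

theorem cmap_cont (F : ℝ → ℝ) (hF : ∀ x, F (x + 1) = F x + 1) (hc : Continuous F) :
    Continuous (cmap F) := by
  have hq : Topology.IsQuotientMap (fun r : ℝ => (r : 𝕊)) := isQuotientMap_quotient_mk'
  rw [hq.continuous_iff]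
  have : cmap F ∘ (fun r : ℝ => (r : 𝕊)) = fun r : ℝ => ((F r : ℝ) : 𝕊) := by
    funext y; exact cmap_coe F hF y
  rw [this]
  exact (AddCircle.continuous_mk' 1).comp hc

theorem exists_circle_homeo (F : ℝ ≃o ℝ) (hF : ∀ x, F (x + 1) = F x + 1) :
    ∃ f : 𝕊 ≃ₜ 𝕊, OrientPres f ∧ ∀ y : ℝ, f (y : 𝕊) = (F y : 𝕊) := by
  have hF' : ∀ x, F.symm (x + 1) = F.symm x + 1 := fun x => by
    rw [OrderIso.symm_apply_eq, hF, OrderIso.apply_symm_apply]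
  let f : 𝕊 ≃ₜ 𝕊 :=
    { toFun := cmap F
      invFun := cmap F.symm
      left_inv := fun p => by
        obtain ⟨y, rfl⟩ : ∃ y : ℝ, (y : 𝕊) = p := ⟨_, coe_toIco p⟩
        rw [cmap_coe F hF, cmap_coe _ hF', OrderIso.symm_apply_apply]
      right_inv := fun p => by
        obtain ⟨y, rfl⟩ : ∃ y : ℝ, (y : 𝕊) = p := ⟨_, coe_toIco p⟩
        rw [cmap_coe _ hF', cmap_coe F hF, OrderIso.apply_symm_apply]
      continuous_toFun := cmap_cont F hF F.continuous
      continuous_invFun := cmap_cont _ hF' F.symm.continuous }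
  have hfc : ∀ y : ℝ, f (y : 𝕊) = (F y : 𝕊) := cmap_coe F hF
  refine ⟨f, ?_, hfc⟩
  intro a b c h
  set α := toIco a
  set β := α + toIco (b - a)
  set γ := α + toIco (c - a)
  have ea : a = (α : 𝕊) := (coe_toIco a).symm
  have eb : b = (β : 𝕊) := by
    rw [AddCircle.coe_add, coe_toIco, coe_toIco]; abel
  have ec : c = (γ : 𝕊) := by
    rw [AddCircle.coe_add, coe_toIco, coe_toIco]; abel
  have h1 : α < β := by have := h.1; simp only [β]; linarith
  have h2 : β < γ := by have := h.2; simp only [β, γ]; linarith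
  have h3 : γ < α + 1 := by have := toIco_lt_one (c - a); simp only [γ]; linarith
  have g1 := F.strictMono h1
  have g2 := F.strictMono h2
  have g3 := F.strictMono h3
  rw [hF] at g3
  have key : ∀ y, F α < y → y < F α + 1 → toIco ((y : 𝕊) - (F α : 𝕊)) = y - F α := by
    intro y hy1 hy2
    rw [← AddCircle.coe_sub, toIco_coe, Int.fract_eq_self]
    constructor <;> linarith
  rw [eb, ec, ea, hfc, hfc, hfc]
  refine ⟨?_, ?_⟩
  · rw [key _ g1 (by linarith)]; linarith
  · rw [key _ g1 (by linarith), key _ (by linarith) g3]; linarith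

/-- A finite grid in the circle. -/
def Grid (m : ℕ) : Set 𝕊 :=
  {y | ∃ r ∈ Finset.range (m + 2), ∃ j ∈ Finset.range (m + 2), ((j / r : ℝ) : 𝕊) = y}

theorem Grid_finite (m : ℕ) : (Grid m).Finite := by
  refine Set.Finite.subset (((Finset.range (m + 2) ×ˢ Finset.range (m + 2)).image
    (fun q : ℕ × ℕ => ((q.2 / q.1 : ℝ) : 𝕊))).finite_toSet) ?_
  rintro y ⟨r, hr, j, hj, rfl⟩
  rw [Finset.mem_coe, Finset.mem_image]
  exact ⟨(r, j), Finset.mem_product.2 ⟨hr, hj⟩, rfl⟩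

/-- Piecewise linear interpolation. -/
def interp (a : ℤ → ℝ) (y : ℝ) : ℝ := a ⌊y⌋ + Int.fract y * (a (⌊y⌋ + 1) - a ⌊y⌋)

theorem interp_strictMono {a : ℤ → ℝ} (ha : StrictMono a) : StrictMono (interp a) := by
  intro y y' h
  simp only [interp]
  have p1 := ha (show ⌊y⌋ < ⌊y⌋ + 1 by omega)
  have p2 := ha (show ⌊y'⌋ < ⌊y'⌋ + 1 by omega)
  have f1 := Int.fract_lt_one y
  have f2 := Int.fract_nonneg y'
  rcases eq_or_lt_of_le (Int.floor_le_floor h.le) with he | hlt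
  · rw [← he]
    have : Int.fract y < Int.fract y' := by
      rw [Int.fract, Int.fract, ← he]; linarith
    nlinarith
  · have : a (⌊y⌋ + 1) ≤ a ⌊y'⌋ := ha.monotone (by omega)
    nlinarith

theorem interp_surj {a : ℤ → ℝ} (ha : StrictMono a) {r : ℤ} (hr : ∀ i, a (i + r) = a i + 1) :
    Function.Surjective (interp a) := by
  intro x
  have hb : ∀ m i : ℤ, a (i + r * m) = a i + m := by
    intro m i
    induction m using Int.induction_on with
    | zero => simp
    | succ m ih =>
      have := hr (i + r * m)
      rw [ih] at this
      rw [show i + r * ((m : ℤ) + 1) = i + r * m + r by ring, this]; push_cast; ring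
    | pred m ih =>
      have := hr (i + r * (-(m : ℤ) - 1))
      rw [show i + r * (-(m : ℤ) - 1) + r = i + r * (-m) by ring, ih] at this
      push_cast at this ⊢
      linarith
  obtain ⟨i, hi, hmax⟩ := Int.exists_greatest_of_bdd (P := fun i => a i ≤ x)
    ⟨0 + r * (⌊x - a 0⌋ + 1), fun i hi => by
      by_contra hlt
      have h1 := ha (not_le.1 hlt)
      rw [hb] at h1
      have := Int.lt_floor_add_one (x - a 0)
      push_cast at h1
      linarith⟩ ⟨0 + r * ⌊x - a 0⌋, by
        rw [hb]
        have := Int.floor_le (x - a 0)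
        linarith⟩
  have hlt : x < a (i + 1) := by
    by_contra hle
    have := hmax (i + 1) (not_lt.1 hle)
    omega
  have hpos : 0 < a (i + 1) - a i := by linarith
  have u0 : 0 ≤ (x - a i) / (a (i + 1) - a i) := div_nonneg (by linarith) hpos.le
  have u1 : (x - a i) / (a (i + 1) - a i) < 1 := by rw [div_lt_one hpos]; linarith
  refine ⟨i + (x - a i) / (a (i + 1) - a i), ?_⟩
  have hfl : ⌊(i : ℝ) + (x - a i) / (a (i + 1) - a i)⌋ = i := by
    rw [Int.floor_eq_iff]; constructor <;> linarith
  rw [interp, Int.fract, hfl]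
  field_simp
  ring

theorem exists_grid_homeo (m : ℕ) (A : Finset 𝕊) (hA : A.card ≤ m) :
    ∃ f : 𝕊 ≃ₜ 𝕊, OrientPres f ∧ ∀ a ∈ A, f a ∈ Grid m := by
  let B : Finset ℝ := insert 0 (A.image toIco)
  have hB01 : ∀ b ∈ B, 0 ≤ b ∧ b < 1 := by
    intro b hb
    rcases Finset.mem_insert.1 hb with rfl | hb
    · exact ⟨le_rfl, one_pos⟩
    · obtain ⟨a, _, rfl⟩ := Finset.mem_image.1 hb
      exact ⟨toIco_nonneg a, toIco_lt_one a⟩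
  obtain ⟨r, hr⟩ : ∃ r, B.card = r := ⟨_, rfl⟩
  have hr1 : 0 < r := by
    rw [← hr]; exact Finset.card_pos.2 ⟨0, Finset.mem_insert_self _ _⟩
  have hrm : r ≤ m + 1 := by
    rw [← hr]
    refine (Finset.card_insert_le _ _).trans ?_
    have := Finset.card_image_le (s := A) (f := toIco)
    omega
  let e := B.orderEmbOfFin hr
  let e' : ℕ → ℝ := fun j => if h : j < r then e ⟨j, h⟩ else 0
  have e'mono : ∀ j, j + 1 < r → e' j < e' (j + 1) := by
    intro j hj
    simp only [e', hj, show j < r by omega, dif_pos]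
    exact e.strictMono (by simp)
  have e'01 : ∀ j, j < r → 0 ≤ e' j ∧ e' j < 1 := by
    intro j hj
    simp only [e', hj, dif_pos]
    exact hB01 _ (B.orderEmbOfFin_mem hr _)
  let a : ℤ → ℝ := fun i => e' (i % r).toNat + ((i / r : ℤ) : ℝ)
  have hrz : (0:ℤ) < r := by exact_mod_cast hr1
  have ha : StrictMono a := by
    refine strictMono_int_of_lt_succ (fun i => ?_)
    have m0 := Int.emod_nonneg i hrz.ne'
    have m1 := Int.emod_lt_of_pos i hrz
    have m2 := Int.mul_ediv_add_emod i r
    set q := i / (r : ℤ) with hq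
    set ρ := i % (r : ℤ) with hρ
    by_cases hc : ρ + 1 < r
    · have t := (Int.ediv_emod_unique (a := i + 1) (b := (r : ℤ)) (r := ρ + 1) (q := q) hrz).2
        ⟨by linarith, by omega, hc⟩
      simp only [a, t.1, t.2, ← hq, ← hρ]
      rw [show (ρ + 1).toNat = ρ.toNat + 1 by omega]
      have := e'mono ρ.toNat (by omega)
      linarith
    · have t := (Int.ediv_emod_unique (a := i + 1) (b := (r : ℤ)) (r := 0) (q := q + 1) hrz).2
        ⟨by have : ρ + 1 = r := by omega
            linarith, le_rfl, hrz⟩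
      simp only [a, t.1, t.2, ← hq, ← hρ]
      have u1 := (e'01 ρ.toNat (by omega)).2
      have u2 := (e'01 0 hr1).1
      simp only [Int.toNat_zero]
      push_cast
      linarith
  have hper : ∀ i, a (i + r) = a i + 1 := by
    intro i
    simp only [a]
    rw [Int.add_emod_right, Int.add_ediv_of_dvd_right (dvd_refl _), Int.ediv_self hrz.ne']
    push_cast; ring
  have hrR : (0:ℝ) < r := by exact_mod_cast hr1
  have hGm : StrictMono (fun z : ℝ => interp a (r * z)) := fun z z' h =>
    interp_strictMono ha (mul_lt_mul_of_pos_left h hrR)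
  have hGs : Function.Surjective (fun z : ℝ => interp a (r * z)) := by
    intro x
    obtain ⟨y, hy⟩ := interp_surj ha hper x
    refine ⟨y / r, ?_⟩
    dsimp only
    rw [mul_div_cancel₀ _ hrR.ne', hy]
  let G := hGm.orderIsoOfSurjective _ hGs
  have hG : ∀ z, G z = interp a (r * z) := fun z => rfl
  have hGper : ∀ z, G (z + 1) = G z + 1 := by
    intro z
    rw [hG, hG, show (r : ℝ) * (z + 1) = r * z + ((r : ℤ) : ℝ) by push_cast; ring]
    simp only [interp, Int.floor_add_intCast, Int.fract_add_intCast]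
    rw [show ⌊(r : ℝ) * z⌋ + (r : ℤ) + 1 = ⌊(r : ℝ) * z⌋ + 1 + r by ring, hper, hper]
    ring
  have hFper : ∀ x, G.symm (x + 1) = G.symm x + 1 := fun x => by
    rw [OrderIso.symm_apply_eq, hGper, OrderIso.apply_symm_apply]
  obtain ⟨f, hf, hfc⟩ := exists_circle_homeo G.symm hFper
  refine ⟨f, hf, fun p hp => ?_⟩
  have hpB : toIco p ∈ B := Finset.mem_insert_of_mem (Finset.mem_image_of_mem _ hp)
  have : toIco p ∈ Set.range (B.orderEmbOfFin hr) := by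
    rw [Finset.range_orderEmbOfFin]; exact hpB
  obtain ⟨⟨j, hj⟩, hje⟩ := this
  have hGj : G (j / r) = toIco p := by
    rw [hG, mul_div_cancel₀ _ hrR.ne']
    simp only [interp, Int.floor_natCast, Int.fract_natCast, zero_mul, add_zero, a]
    have hz : ((j : ℤ)) < r := by exact_mod_cast hj
    rw [Int.emod_eq_of_lt (by positivity) hz, Int.ediv_eq_zero_of_lt (by positivity) hz]
    simp only [Int.toNat_natCast, e', hj, dif_pos, Int.cast_zero, add_zero]
    exact hje
  refine ⟨r, Finset.mem_range.2 (by omega), j, Finset.mem_range.2 (by omega), ?_⟩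
  rw [← coe_toIco p, hfc, ← hGj, OrderIso.symm_apply_apply]

theorem sdata_subset (x : ℤ → ℝ → ℝ) (n : ℤ) (G : Set 𝕊) :
    sdata x n G ⊆ Icc (-4 * n) (4 * n) ×ˢ (G ×ˢ G) :=
  fun _ hq => ⟨hq.1, hq.2.1, hq.2.2.1⟩

/-- Every diagram can be moved so that its double points lie in the grid. -/
theorem exists_grid_map (R : RectDiagram) (m : ℕ) (hm : (DoublePts R).ncard = m) :
    ∃ f g : 𝕊 ≃ₜ 𝕊, OrientPres f ∧ OrientPres g ∧
      DoublePts (mapR f g R) ⊆ Grid m ×ˢ Grid m := by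
  have hfin := double_finite R
  have hcard : hfin.toFinset.card = m := by rw [← hm, Set.ncard_eq_toFinset_card _ hfin]
  obtain ⟨f, hf, hfG⟩ := exists_grid_homeo m (hfin.toFinset.image Prod.fst)
    (Finset.card_image_le.trans hcard.le)
  obtain ⟨g, hg, hgG⟩ := exists_grid_homeo m (hfin.toFinset.image Prod.snd)
    (Finset.card_image_le.trans hcard.le)
  refine ⟨f, g, hf, hg, fun p hp => ?_⟩
  obtain ⟨p, rfl⟩ := (prodH f g).surjective p
  rw [mapR_double hf hg] at hp
  have hpF := hfin.mem_toFinset.2 hp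
  exact ⟨hfG _ (Finset.mem_image_of_mem _ hpF), hgG _ (Finset.mem_image_of_mem _ hpF)⟩

/-- A diagram in grid position with given strand data. -/
def HasData (k l m : ℕ) (R : RectDiagram) (d : Set (ℤ × Torus)) : Prop :=
  DoublePts R ⊆ Grid m ×ˢ Grid m ∧ ∃ x, Describes R (k + l) k x ∧ 0 ≤ x 0 0 ∧ x 0 0 < 1 ∧
    sdata x (k + l) (Grid m) = d

/-- for each fixed `(k,l,m)` with `k, l ≥ 1`, there are only finitely
many `→II`-homology types of rectangular diagrams `R` with `ω_→II(R) = (k,l,m)`. -/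
theorem stmt14 (k l m : ℕ) (hk : 1 ≤ k) (hl : 1 ≤ l) :
    ∃ Rs : List RectDiagram, ∀ R : RectDiagram,
      IsHomClass R k l → (DoublePts R).ncard = m →
      ∃ R' ∈ Rs, SameHomType R R' := by
  have hpos : (0:ℤ) < k + l := by omega
  have hfin : {d : Set (ℤ × Torus) | ∃ R, HasData k l m R d}.Finite := by
    have hbox : ((Icc (-4 * (k + l : ℤ)) (4 * (k + l : ℤ))) ×ˢ (Grid m ×ˢ Grid m)).Finite :=
      (Set.finite_Icc _ _).prod ((Grid_finite m).prod (Grid_finite m))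
    refine hbox.finite_subsets.subset ?_
    rintro d ⟨R, _, x, _, _, _, rfl⟩
    exact sdata_subset _ _ _
  have hch : ∀ d : {d : Set (ℤ × Torus) | ∃ R, HasData k l m R d}, ∃ R, HasData k l m R d.1 :=
    fun d => d.2
  choose rep hrep using hch
  have : Finite {d : Set (ℤ × Torus) | ∃ R, HasData k l m R d} := hfin
  have hfr : (Set.range rep).Finite := Set.finite_range rep
  refine ⟨hfr.toFinset.toList, fun R hR hm => ?_⟩
  obtain ⟨f, g, hf, hg, hG⟩ := exists_grid_map R m hm
  obtain ⟨x, D, h0, h1⟩ := exists_describes_norm (mapR f g R) hk (mapR_homClass hf hg hR)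
  have hd : HasData k l m (mapR f g R) (sdata x (k + l) (Grid m)) := ⟨hG, x, D, h0, h1, rfl⟩
  obtain ⟨hG', x', D', h0', h1', he⟩ := hrep ⟨_, ⟨_, hd⟩⟩
  refine ⟨rep ⟨_, ⟨_, hd⟩⟩, ?_, ?_⟩
  · rw [Finset.mem_toList, Set.Finite.mem_toFinset]
    exact ⟨_, rfl⟩
  · exact sameHom_of_map hf hg
      (isotopic_of_sdata hpos D D' h0 h1 h0' h1' (Grid m) hG hG' he.symm)

end
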